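/- Theorem 5.4: Let m ∈ ℕ⁺ and suppose the cut-offs 𝒳 and 𝒴_ε are of class C^{m+3}. Suppose that for each N the perturbed coefficients (L̃̂_{dj})_{j∈S_N} satisfy Σ_{j∈S_N} |L̂_{dj} − L̃̂_{dj}| ≤ C₀ N^{−2} (FFT error), let L̃_{dN} = Σ_{j∈S_N} L̃̂_{dj} φ_j, and suppose Ĩ_N : D_{dc̃} → ℂ satisfies |Ĩ_N(x) − L̃_{dN}(x)| ≤ C₁ N^{−4} for all x ∈ D_{dc̃} (interpolation error). Define G̃_{dN}(x) = e^{iα₁x₁+iα₂x₂} ( Ĩ_N(x) + F(x) ). Then, with σ = min{2, m}, there is a constant C > 0 independent of N such that for every x ∈ [−π,π]² × [−c,c] with x₃ ≠ 0, | G_d(x) − G̃_{dN}(x) | ≤ C N^{−σ}. -/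

import Mathlib

open MeasureTheory Complex Real

noncomputable section

/-- β_{n₁,n₂} from the eigenfunction expansion of the 3D doubly quasi-periodic
Green's function. -/
def betaCoef3 (k α₁ α₂ : ℝ) (n : ℤ × ℤ) : ℂ :=
  if (α₁ + (n.1 : ℝ)) ^ 2 + (α₂ + (n.2 : ℝ)) ^ 2 ≤ k ^ 2 then
    ((Real.sqrt (k ^ 2 - (α₁ + (n.1 : ℝ)) ^ 2 - (α₂ + (n.2 : ℝ)) ^ 2) : ℝ) : ℂ)
  else Complex.I * ((Real.sqrt ((α₁ + (n.1 : ℝ)) ^ 2 + (α₂ + (n.2 : ℝ)) ^ 2 - k ^ 2) : ℝ) : ℂ)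

/-- The doubly quasi-periodic Green's function (eigenfunction expansion). -/
def greenGd (k α₁ α₂ : ℝ) (x : EuclideanSpace ℝ (Fin 3)) : ℂ :=
  (Complex.I / (8 * (π : ℂ) ^ 2)) *
    ∑' n : ℤ × ℤ, (1 / betaCoef3 k α₁ α₂ n) *
      Complex.exp (Complex.I * ((α₁ + (n.1 : ℝ) : ℝ) : ℂ) * (x 0 : ℂ) +
        Complex.I * ((α₂ + (n.2 : ℝ) : ℝ) : ℂ) * (x 1 : ℂ) +
        Complex.I * betaCoef3 k α₁ α₂ n * ((|x 2| : ℝ) : ℂ))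

/-- K_d(x) = e^{−iα₁x₁−iα₂x₂} G_d(x) 𝒳(|x₃|). -/
def funKd (k α₁ α₂ : ℝ) (𝒳 : ℝ → ℝ) (x : EuclideanSpace ℝ (Fin 3)) : ℂ :=
  Complex.exp (-Complex.I * (α₁ : ℂ) * (x 0 : ℂ) - Complex.I * (α₂ : ℂ) * (x 1 : ℂ)) *
    greenGd k α₁ α₂ x * ((𝒳 |x 2| : ℝ) : ℂ)

/-- The box D_{dc̃} = [−π,π]² × [−c̃,c̃]. -/
def domDd (ct : ℝ) : Set (EuclideanSpace ℝ (Fin 3)) :=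
  {x | x 0 ∈ Set.Icc (-π) π ∧ x 1 ∈ Set.Icc (-π) π ∧ x 2 ∈ Set.Icc (-ct) ct}

/-- The Fourier basis φ_j(x) = (1/√(8π²c̃)) e^{i(j₁x₁ + j₂x₂ + j₃πx₃/c̃)}. -/
def fBasis3 (ct : ℝ) (j : ℤ × ℤ × ℤ) (x : EuclideanSpace ℝ (Fin 3)) : ℂ :=
  (1 / Real.sqrt (8 * π ^ 2 * ct) : ℝ) *
    Complex.exp (Complex.I * ((j.1 : ℂ) * (x 0 : ℂ) + (j.2.1 : ℂ) * (x 1 : ℂ) +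
      (j.2.2 : ℂ) * (π : ℂ) * (x 2 : ℂ) / (ct : ℂ)))

/-- The j-th Fourier coefficient ĝ_j = ∫_{D_{dc̃}} g(x) φ_{−j}(x) dx. -/
def fourierCoef3 (ct : ℝ) (g : EuclideanSpace ℝ (Fin 3) → ℂ) (j : ℤ × ℤ × ℤ) : ℂ :=
  ∫ x in domDd ct, g x * fBasis3 ct (-j) x

/-- F(x) = e^{−iα₁x₁−iα₂x₂} (e^{ik|x|}/(4π|x|)) 𝒴_ε(|x|). -/
def funF3 (k α₁ α₂ : ℝ) (𝒴 : ℝ → ℝ) (x : EuclideanSpace ℝ (Fin 3)) : ℂ :=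
  Complex.exp (-Complex.I * (α₁ : ℂ) * (x 0 : ℂ) - Complex.I * (α₂ : ℂ) * (x 1 : ℂ)) *
    (Complex.exp (Complex.I * (k : ℂ) * (‖x‖ : ℂ)) / (4 * (π : ℂ) * (‖x‖ : ℂ))) *
    ((𝒴 ‖x‖ : ℝ) : ℂ)

/-- L_d = K_d − F. -/
def funLd (k α₁ α₂ : ℝ) (𝒳 𝒴 : ℝ → ℝ) (x : EuclideanSpace ℝ (Fin 3)) : ℂ :=
  funKd k α₁ α₂ 𝒳 x - funF3 k α₁ α₂ 𝒴 x

/-- S_N = {j ∈ ℤ³ : −N ≤ j₁,j₂,j₃ < N}. -/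
def cubeIdx (N : ℕ) : Finset (ℤ × ℤ × ℤ) :=
  Finset.Icc (-(N : ℤ)) ((N : ℤ) - 1) ×ˢ
    (Finset.Icc (-(N : ℤ)) ((N : ℤ) - 1) ×ˢ Finset.Icc (-(N : ℤ)) ((N : ℤ) - 1))

/-- L_{dN} = Σ_{j∈S_N} L̂_{dj} φ_j. -/
def funLdN (k α₁ α₂ ct : ℝ) (𝒳 𝒴 : ℝ → ℝ) (N : ℕ) (x : EuclideanSpace ℝ (Fin 3)) : ℂ :=
  ∑ j ∈ cubeIdx N, fourierCoef3 ct (funLd k α₁ α₂ 𝒳 𝒴) j * fBasis3 ct j x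

/-- One integration by parts in the Laplace-type integral of an iterated derivative. -/
theorem integral_iteratedDeriv_mul_cexp {p q : ℕ} (hq : q < p) {R : ℝ} {χ : ℝ → ℝ}
    (hχ : ContDiff ℝ p χ) {l : ℂ} (hl : l ≠ 0) :
    ∫ t in (0 : ℝ)..R, ((iteratedDeriv q χ t : ℝ) : ℂ) * Complex.exp (l * t) =
      ((iteratedDeriv q χ R : ℝ) : ℂ) * (Complex.exp (l * R) / l) - ((iteratedDeriv q χ 0 : ℝ) : ℂ) / l +
        (-1 / l) * ∫ t in (0 : ℝ)..R, ((iteratedDeriv (q + 1) χ t : ℝ) : ℂ) * Complex.exp (l * t) := by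
  have hd : Differentiable ℝ (iteratedDeriv q χ) :=
    hχ.differentiable_iteratedDeriv q (by exact_mod_cast hq)
  have hc : Continuous (iteratedDeriv (q + 1) χ) :=
    hχ.continuous_iteratedDeriv (q + 1) (by exact_mod_cast hq)
  have hu : ∀ x ∈ Set.uIcc 0 R, HasDerivAt (fun t : ℝ => ((iteratedDeriv q χ t : ℝ) : ℂ))
      ((iteratedDeriv (q + 1) χ x : ℝ) : ℂ) x := by
    intro x _
    rw [iteratedDeriv_succ]
    exact (hd x).hasDerivAt.ofReal_comp
  have hv : ∀ x ∈ Set.uIcc 0 R, HasDerivAt (fun t : ℝ => Complex.exp (l * t) / l)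
      (Complex.exp (l * x)) x := by
    intro x _
    have h1 : HasDerivAt (fun t : ℝ => l * (t : ℂ)) (l * 1) x :=
      (Complex.ofRealCLM.hasDerivAt (x := x)).const_mul l
    have h2 := h1.cexp.div_const l
    exact h2.congr_deriv (by rw [mul_one, mul_div_assoc, div_self hl, mul_one])
  have key := intervalIntegral.integral_mul_deriv_eq_deriv_mul hu hv
    (Continuous.intervalIntegrable (by fun_prop) _ _)
    (Continuous.intervalIntegrable (by fun_prop) _ _)
  rw [key]
  have h3 : ∫ x in (0 : ℝ)..R, ((iteratedDeriv (q + 1) χ x : ℝ) : ℂ) * (Complex.exp (l * x) / l) =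
      (1 / l) * ∫ x in (0 : ℝ)..R, ((iteratedDeriv (q + 1) χ x : ℝ) : ℂ) * Complex.exp (l * x) := by
    rw [← intervalIntegral.integral_const_mul]
    congr 1; ext x; ring
  rw [h3]
  simp
  ring

/-- The Laplace transform of a cut-off function that equals one near the origin. -/
theorem integral_cutoff_mul_cexp {p : ℕ} (hp : 0 < p) {R : ℝ} {χ : ℝ → ℝ}
    (hχ : ContDiff ℝ p χ) (h0 : χ =ᶠ[nhds 0] fun _ => 1) (hR : χ =ᶠ[nhds R] fun _ => 0)
    {l : ℂ} (hl : l ≠ 0) :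
    ∫ t in (0 : ℝ)..R, (χ t : ℂ) * Complex.exp (l * t) =
      -1 / l + (-1 / l) ^ p *
        ∫ t in (0 : ℝ)..R, ((iteratedDeriv p χ t : ℝ) : ℂ) * Complex.exp (l * t) := by
  have hRq : ∀ q, iteratedDeriv q χ R = 0 := by
    intro q
    rw [hR.iteratedDeriv_eq q]; simp
  have h0q : ∀ q, iteratedDeriv (q + 1) χ 0 = 0 := by
    intro q
    rw [h0.iteratedDeriv_eq (q + 1)]; simp [iteratedDeriv_const]
  have main : ∀ q, q < p → ∫ t in (0 : ℝ)..R, (χ t : ℂ) * Complex.exp (l * t) =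
      -1 / l + (-1 / l) ^ (q + 1) *
        ∫ t in (0 : ℝ)..R, ((iteratedDeriv (q + 1) χ t : ℝ) : ℂ) * Complex.exp (l * t) := by
    intro q
    induction q with
    | zero =>
      intro hq
      have := integral_iteratedDeriv_mul_cexp hq (R := R) hχ hl
      rw [hRq, iteratedDeriv_zero, h0.eq_of_nhds] at this
      rw [this]; push_cast; ring
    | succ q ih =>
      intro hq
      rw [ih (by omega), integral_iteratedDeriv_mul_cexp hq (R := R) hχ hl, hRq, h0q]
      push_cast; ring
  obtain ⟨q, rfl⟩ := Nat.exists_eq_succ_of_ne_zero hp.ne'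
  exact main q (Nat.lt_succ_self q)

/-- The decay of the remainder in `integral_cutoff_mul_cexp`. -/
theorem exists_norm_integral_cutoff_le {p : ℕ} (hp : 0 < p) {R : ℝ} (hRpos : 0 < R) {χ : ℝ → ℝ}
    (hχ : ContDiff ℝ p χ) (h0 : χ =ᶠ[nhds 0] fun _ => 1) (hR : χ =ᶠ[nhds R] fun _ => 0) :
    ∃ M : ℝ, 0 < M ∧ ∀ l : ℂ, l ≠ 0 → l.re ≤ 0 →
      ‖(∫ t in (0 : ℝ)..R, (χ t : ℂ) * Complex.exp (l * t)) + 1 / l‖ ≤ M / ‖l‖ ^ p := by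
  have hc : Continuous (iteratedDeriv p χ) := hχ.continuous_iteratedDeriv p le_rfl
  obtain ⟨B, hB⟩ := (isCompact_Icc (a := (0 : ℝ)) (b := R)).exists_bound_of_continuousOn
    hc.continuousOn
  have hB0 : 0 ≤ B := (norm_nonneg _).trans (hB 0 ⟨le_rfl, hRpos.le⟩)
  refine ⟨(B + 1) * R, by positivity, fun l hl hre => ?_⟩
  rw [integral_cutoff_mul_cexp hp hχ h0 hR hl]
  have h1 : ‖∫ t in (0 : ℝ)..R, ((iteratedDeriv p χ t : ℝ) : ℂ) * Complex.exp (l * t)‖ ≤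
      (B + 1) * |R - 0| := by
    apply intervalIntegral.norm_integral_le_of_norm_le_const
    intro t ht
    rw [Set.uIoc_of_le hRpos.le] at ht
    have h2 : ‖Complex.exp (l * t)‖ ≤ 1 := by
      rw [Complex.norm_exp, Real.exp_le_one_iff]
      simpa using mul_nonpos_of_nonpos_of_nonneg hre ht.1.le
    have h3 := hB t ⟨ht.1.le, ht.2⟩
    rw [norm_mul, Complex.norm_real]
    calc _ ≤ B * 1 := by gcongr
      _ ≤ B + 1 := by linarith
  rw [sub_zero, abs_of_pos hRpos] at h1
  have h4 : -1 / l + (-1 / l) ^ p * (∫ t in (0 : ℝ)..R,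
      ((iteratedDeriv p χ t : ℝ) : ℂ) * Complex.exp (l * t)) + 1 / l =
      (-1 / l) ^ p * (∫ t in (0 : ℝ)..R,
      ((iteratedDeriv p χ t : ℝ) : ℂ) * Complex.exp (l * t)) := by ring
  rw [h4, norm_mul, norm_pow, norm_div, norm_neg, norm_one, one_div, inv_pow,
    inv_mul_eq_div]
  gcongr

/-- Folding the integral of a function of `|t|` against an exponential onto the half line. -/
theorem integral_abs_mul_cexp {R : ℝ} {g : ℝ → ℂ} (hg : Continuous g) (w : ℝ) :
    ∫ t in (-R)..R, g |t| * Complex.exp (-(Complex.I * w * t)) =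
      (∫ t in (0 : ℝ)..R, g |t| * Complex.exp (-(Complex.I * w * t))) +
        ∫ t in (0 : ℝ)..R, g |t| * Complex.exp (Complex.I * w * t) := by
  have hi : ∀ a b : ℝ, IntervalIntegrable
      (fun t : ℝ => g |t| * Complex.exp (-(Complex.I * w * t))) volume a b :=
    fun a b => Continuous.intervalIntegrable (by fun_prop) _ _
  rw [← intervalIntegral.integral_add_adjacent_intervals (hi (-R) 0) (hi 0 R), add_comm]
  congr 1
  have := intervalIntegral.integral_comp_neg (a := (0 : ℝ)) (b := R)
    (fun t : ℝ => g |t| * Complex.exp (-(Complex.I * w * t)))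
  simp only [neg_zero] at this
  rw [← this]
  apply intervalIntegral.integral_congr
  intro t _
  simp

/-- The splitting `x ↦ (x₃, (x₁, x₂))` of Euclidean three-space. -/
def coordSplit : EuclideanSpace ℝ (Fin 3) ≃ᵐ ℝ × (ℝ × ℝ) :=
  (MeasurableEquiv.toLp 2 (Fin 3 → ℝ)).symm.trans
    ((MeasurableEquiv.piFinSuccAbove (fun _ : Fin 3 => ℝ) 2).trans
      ((MeasurableEquiv.refl ℝ).prodCongr MeasurableEquiv.finTwoArrow))

theorem coordSplit_apply (x : EuclideanSpace ℝ (Fin 3)) :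
    coordSplit x = (x 2, (x 0, x 1)) := rfl

theorem measurePreserving_coordSplit : MeasurePreserving coordSplit volume volume :=
  (((MeasurePreserving.id volume).prod (volume_preserving_finTwoArrow ℝ)).comp
    (volume_preserving_piFinSuccAbove (fun _ : Fin 3 => ℝ) 2)).comp
      (EuclideanSpace.volume_preserving_symm_measurableEquiv_toLp (Fin 3))

theorem norm_eq_sqrt_coord (x : EuclideanSpace ℝ (Fin 3)) :
    ‖x‖ = Real.sqrt (x 2 ^ 2 + (x 0 ^ 2 + x 1 ^ 2)) := by
  rw [EuclideanSpace.norm_eq, Fin.sum_univ_three]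
  simp only [Real.norm_eq_abs, sq_abs]
  congr 1; ring

theorem integrableOn_Ioi_of_continuous_of_eq_zero {g : ℝ → ℂ} (hg : Continuous g) {R : ℝ}
    (hz : ∀ t, R ≤ t → g t = 0) : IntegrableOn g (Set.Ioi 0) := by
  have h1 : IntegrableOn g (Set.Ioi 0 ∩ Set.Iic R) :=
    (hg.integrableOn_Icc (a := 0) (b := R)).mono_set fun t ht => ⟨le_of_lt ht.1, ht.2⟩
  have h2 : IntegrableOn g (Set.Ioi R) :=
    integrableOn_zero.congr_fun (fun t ht => (hz t (le_of_lt ht)).symm) measurableSet_Ioi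
  refine (h1.union h2).mono_set fun t ht => ?_
  rcases le_or_gt t R with h | h
  · exact Or.inl ⟨ht, h⟩
  · exact Or.inr h

/-- A radial function with a first order singularity and compact support is integrable. -/
theorem integrable_radial_div {Ψ : ℝ → ℂ} (hΨ : Continuous Ψ) {R : ℝ}
    (hz : ∀ t, R ≤ t → Ψ t = 0) :
    Integrable (fun x : EuclideanSpace ℝ (Fin 3) => Ψ ‖x‖ / (4 * π * ‖x‖)) := by
  have := (integrable_fun_norm_addHaar (E := EuclideanSpace ℝ (Fin 3)) volume
    (f := fun r : ℝ => Ψ r / (4 * π * r))).2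
  apply this
  have h1 : IntegrableOn (fun y : ℝ => (y : ℂ) * Ψ y / (4 * π)) (Set.Ioi 0) := by
    refine integrableOn_Ioi_of_continuous_of_eq_zero (R := R) (by fun_prop) fun t ht => ?_
    simp [hz t ht]
  refine h1.congr_fun (fun y hy => ?_) measurableSet_Ioi
  have hy' : (y : ℂ) ≠ 0 := by exact_mod_cast (ne_of_gt hy)
  have hpi : (π : ℂ) ≠ 0 := by exact_mod_cast Real.pi_ne_zero
  simp only [finrank_euclideanSpace, Fintype.card_fin, Complex.real_smul]
  push_cast
  field_simp

/-- Integral of a radial function with first order singularity over a plane at distance `|z|`. -/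
theorem integral_plane_radial_div {Ψ : ℝ → ℂ} (hΨ : Continuous Ψ) {R : ℝ}
    (hz : ∀ t, R ≤ t → Ψ t = 0) {z : ℝ} (hz0 : z ≠ 0) :
    ∫ y : ℝ × ℝ, Ψ (Real.sqrt (z ^ 2 + (y.1 ^ 2 + y.2 ^ 2))) /
        (4 * π * (Real.sqrt (z ^ 2 + (y.1 ^ 2 + y.2 ^ 2)) : ℝ)) =
      -(1 / 2) * ∫ t in R..|z|, Ψ t := by
  have hpi : (π : ℂ) ≠ 0 := by exact_mod_cast Real.pi_ne_zero
  have hzz : 0 < z ^ 2 := by positivity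
  have hpos : ∀ ρ : ℝ, 0 < z ^ 2 + ρ ^ 2 := fun ρ => by positivity
  have hspos : ∀ ρ : ℝ, 0 < Real.sqrt (z ^ 2 + ρ ^ 2) := fun ρ => Real.sqrt_pos.2 (hpos ρ)
  rw [← integral_comp_polarCoord_symm]
  have e1 : ∀ p : ℝ × ℝ, p.1 • (Ψ (Real.sqrt (z ^ 2 + ((polarCoord.symm p).1 ^ 2 +
      (polarCoord.symm p).2 ^ 2))) / (4 * π * (Real.sqrt (z ^ 2 + ((polarCoord.symm p).1 ^ 2 +
      (polarCoord.symm p).2 ^ 2)) : ℝ))) =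
      (fun ρ : ℝ => (ρ : ℂ) * (Ψ (Real.sqrt (z ^ 2 + ρ ^ 2)) /
        (4 * π * (Real.sqrt (z ^ 2 + ρ ^ 2) : ℝ)))) p.1 * (fun _ : ℝ => (1 : ℂ)) p.2 := by
    intro p
    have : (polarCoord.symm p).1 ^ 2 + (polarCoord.symm p).2 ^ 2 = p.1 ^ 2 := by
      simp only [polarCoord_symm_apply]
      nlinarith [Real.sin_sq_add_cos_sq p.2]
    rw [this]; simp
  simp_rw [e1]
  rw [polarCoord_target, Measure.volume_eq_prod]
  refine (setIntegral_prod_mul (fun ρ : ℝ => (ρ : ℂ) * (Ψ (Real.sqrt (z ^ 2 + ρ ^ 2)) /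
    (4 * π * (Real.sqrt (z ^ 2 + ρ ^ 2) : ℝ)))) (fun _ : ℝ => (1 : ℂ)) _ _).trans ?_
  have hP : ∀ r : ℝ, HasDerivAt (fun r => ∫ t in R..r, Ψ t) (Ψ r) r := fun r =>
    intervalIntegral.integral_hasDerivAt_right (hΨ.intervalIntegrable _ _)
      (hΨ.stronglyMeasurableAtFilter _ _) hΨ.continuousAt
  have hder : ∀ ρ : ℝ, HasDerivAt
      (fun ρ : ℝ => (1 / (4 * π) : ℂ) * ∫ t in R..Real.sqrt (z ^ 2 + ρ ^ 2), Ψ t)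
      ((ρ : ℂ) * (Ψ (Real.sqrt (z ^ 2 + ρ ^ 2)) /
        (4 * π * (Real.sqrt (z ^ 2 + ρ ^ 2) : ℝ)))) ρ := by
    intro ρ
    have h1 : HasDerivAt (fun ρ : ℝ => Real.sqrt (z ^ 2 + ρ ^ 2))
        (ρ / Real.sqrt (z ^ 2 + ρ ^ 2)) ρ := by
      have h0 : HasDerivAt (fun ρ : ℝ => z ^ 2 + ρ ^ 2) (2 * ρ) ρ := by
        simpa using (hasDerivAt_pow 2 ρ).const_add (z ^ 2)
      refine (h0.sqrt (hpos ρ).ne').congr_deriv ?_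
      rw [mul_div_mul_left _ _ two_ne_zero]
    have h2 := ((hP (Real.sqrt (z ^ 2 + ρ ^ 2))).scomp ρ h1).const_mul (1 / (4 * π) : ℂ)
    refine h2.congr_deriv ?_
    have h3 : ((Real.sqrt (z ^ 2 + ρ ^ 2) : ℝ) : ℂ) ≠ 0 := by exact_mod_cast (hspos ρ).ne'
    rw [Complex.real_smul]
    push_cast
    field_simp
  have hlarge : ∀ ρ : ℝ, max R 0 ≤ ρ → R ≤ Real.sqrt (z ^ 2 + ρ ^ 2) := by
    intro ρ hρ
    refine (le_max_left R 0).trans (hρ.trans (Real.le_sqrt_of_sq_le ?_))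
    linarith
  have hzero : ∀ r, R ≤ r → ∫ t in R..r, Ψ t = 0 := by
    intro r hr
    rw [intervalIntegral.integral_congr (g := fun _ => (0 : ℂ))]
    · simp
    · intro t ht
      rw [Set.uIcc_of_le hr] at ht
      exact hz t ht.1
  have hcont : Continuous (fun ρ : ℝ => (ρ : ℂ) * (Ψ (Real.sqrt (z ^ 2 + ρ ^ 2)) /
        (4 * π * (Real.sqrt (z ^ 2 + ρ ^ 2) : ℝ)))) := by
    have : ∀ ρ : ℝ, (4 * π * (Real.sqrt (z ^ 2 + ρ ^ 2) : ℝ) : ℂ) ≠ 0 := by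
      intro ρ
      have h3 : ((Real.sqrt (z ^ 2 + ρ ^ 2) : ℝ) : ℂ) ≠ 0 := by exact_mod_cast (hspos ρ).ne'
      simp [hpi, h3]
    have hΨ' : Continuous fun ρ : ℝ => Ψ (Real.sqrt (z ^ 2 + ρ ^ 2)) := by fun_prop
    exact Complex.continuous_ofReal.mul (hΨ'.div (by fun_prop) this)
  have hI := integral_Ioi_of_hasDerivAt_of_tendsto (a := (0 : ℝ)) (m := 0)
    (hder 0).continuousAt.continuousWithinAt (fun x _ => hder x)
    (integrableOn_Ioi_of_continuous_of_eq_zero (R := max R 0) hcont fun t ht => by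
      rw [hz _ (hlarge t ht)]; simp)
    (tendsto_const_nhds.congr' (by
      filter_upwards [Filter.eventually_ge_atTop (max R 0)] with ρ hρ
      rw [hzero _ (hlarge ρ hρ)]; simp))
  rw [hI]
  simp only [ne_eq, OfNat.ofNat_ne_zero, not_false_eq_true, zero_pow, add_zero, Real.sqrt_sq_eq_abs,
    integral_const, MeasurableSet.univ, measureReal_restrict_apply, Set.univ_inter]
  rw [Real.volume_real_Ioo_of_le (by linarith [Real.pi_pos])]
  rw [Complex.real_smul]
  push_cast
  field_simp
  ring

/-- The Fourier transform of a compactly supported radial function with first order singularity,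
in the direction of the third axis. -/
theorem integral_radial_div_mul_cexp {Ψ : ℝ → ℂ} (hΨ : Continuous Ψ) {R : ℝ} (hR : 0 < R)
    (hz : ∀ t, R ≤ t → Ψ t = 0) {w : ℝ} (hw : w ≠ 0) :
    ∫ x : EuclideanSpace ℝ (Fin 3), Ψ ‖x‖ / (4 * π * ‖x‖) * Complex.exp (-(Complex.I * w * x 2)) =
      1 / (2 * Complex.I * w) * ((∫ t in (0 : ℝ)..R, Ψ t * Complex.exp (Complex.I * w * t)) -
        ∫ t in (0 : ℝ)..R, Ψ t * Complex.exp (-(Complex.I * w * t))) := by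
  have hwC : (w : ℂ) ≠ 0 := by exact_mod_cast hw
  let G : ℝ × (ℝ × ℝ) → ℂ := fun p =>
    Ψ (Real.sqrt (p.1 ^ 2 + (p.2.1 ^ 2 + p.2.2 ^ 2))) /
        (4 * π * (Real.sqrt (p.1 ^ 2 + (p.2.1 ^ 2 + p.2.2 ^ 2)) : ℝ)) *
        Complex.exp (-(Complex.I * w * p.1))
  have hG : ∀ x : EuclideanSpace ℝ (Fin 3),
      Ψ ‖x‖ / (4 * π * ‖x‖) * Complex.exp (-(Complex.I * w * x 2)) = G (coordSplit x) := by
    intro x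
    simp only [G, coordSplit_apply, norm_eq_sqrt_coord]
  have hint : Integrable G := by
    rw [← measurePreserving_coordSplit.integrable_comp_emb coordSplit.measurableEmbedding]
    refine Integrable.congr ?_ (ae_of_all _ hG)
    refine (integrable_radial_div hΨ hz).mul_bdd (c := 1) ?_ (ae_of_all _ fun x => ?_)
    · exact Continuous.aestronglyMeasurable (by fun_prop)
    · rw [Complex.norm_exp]; simp
  simp_rw [hG]
  rw [measurePreserving_coordSplit.integral_comp coordSplit.measurableEmbedding,
    Measure.volume_eq_prod, integral_prod _ (by rwa [← Measure.volume_eq_prod])]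
  have hP : ∀ r : ℝ, HasDerivAt (fun r => ∫ t in R..r, Ψ t) (Ψ r) r := fun r =>
    intervalIntegral.integral_hasDerivAt_right (hΨ.intervalIntegrable _ _)
      (hΨ.stronglyMeasurableAtFilter _ _) hΨ.continuousAt
  set P : ℝ → ℂ := fun r => ∫ t in R..r, Ψ t with hPdef
  have hPc : Continuous P := continuous_iff_continuousAt.2 fun r => (hP r).continuousAt
  have hPz : ∀ r, R ≤ r → P r = 0 := by
    intro r hr
    simp only [hPdef]
    rw [intervalIntegral.integral_congr (g := fun _ => (0 : ℂ))]
    · simp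
    · intro t ht
      rw [Set.uIcc_of_le hr] at ht
      exact hz t ht.1
  have h1 : (fun z : ℝ => ∫ y : ℝ × ℝ, G (z, y)) =ᵐ[volume]
      fun z : ℝ => (-(1 / 2) * P |z|) * Complex.exp (-(Complex.I * w * z)) := by
    have : ∀ᵐ z : ℝ, z ≠ 0 := by simp [ae_iff, measure_singleton]
    filter_upwards [this] with z hz0
    simp only [G]
    rw [integral_mul_const, integral_plane_radial_div hΨ hz hz0]
  rw [integral_congr_ae h1, ← setIntegral_eq_integral_of_forall_compl_eq_zero (s := Set.Ioc (-R) R)]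
  swap
  · intro z hzR
    have : R ≤ |z| := by
      by_contra! h
      exact hzR ⟨(abs_lt.1 h).1, (abs_lt.1 h).2.le⟩
    simp [hPz _ this]
  rw [← intervalIntegral.integral_of_le (by linarith),
    integral_abs_mul_cexp (g := fun t => -(1 / 2) * P t) (by fun_prop)]
  have hparts : ∀ s : ℂ, s ≠ 0 → ∫ t in (0 : ℝ)..R, (-(1 / 2) * P |t|) * Complex.exp (s * t) =
      (1 / 2) * (P 0 / s) + (1 / (2 * s)) * ∫ t in (0 : ℝ)..R, Ψ t * Complex.exp (s * t) := by
    intro s hs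
    have hu : ∀ x ∈ Set.uIcc 0 R, HasDerivAt P (Ψ x) x := fun x _ => hP x
    have hv : ∀ x ∈ Set.uIcc 0 R, HasDerivAt (fun t : ℝ => Complex.exp (s * t) / s)
        (Complex.exp (s * x)) x := by
      intro x _
      have h1 : HasDerivAt (fun t : ℝ => s * (t : ℂ)) (s * 1) x :=
        (Complex.ofRealCLM.hasDerivAt (x := x)).const_mul s
      have h2 := h1.cexp.div_const s
      exact h2.congr_deriv (by rw [mul_one, mul_div_assoc, div_self hs, mul_one])
    have key := intervalIntegral.integral_mul_deriv_eq_deriv_mul hu hv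
      (Continuous.intervalIntegrable (by fun_prop) _ _)
      (Continuous.intervalIntegrable (by fun_prop) _ _)
    have e1 : ∫ t in (0 : ℝ)..R, (-(1 / 2) * P |t|) * Complex.exp (s * t) =
        -(1 / 2) * ∫ t in (0 : ℝ)..R, P t * Complex.exp (s * t) := by
      rw [← intervalIntegral.integral_const_mul]
      apply intervalIntegral.integral_congr
      intro t ht
      rw [Set.uIcc_of_le hR.le] at ht
      simp only [abs_of_nonneg ht.1]; ring
    have e2 : ∫ t in (0 : ℝ)..R, Ψ t * (Complex.exp (s * t) / s) =
        (1 / s) * ∫ t in (0 : ℝ)..R, Ψ t * Complex.exp (s * t) := by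
      rw [← intervalIntegral.integral_const_mul]
      congr 1; ext t; ring
    rw [e1, key, e2, hPz R le_rfl]
    simp
    field_simp
    ring
  have hp1 := hparts (Complex.I * w) (by simp [hw])
  have hp2 := hparts (-(Complex.I * w)) (by simp [hw])
  simp only [neg_mul] at hp1 hp2 ⊢
  rw [hp1, hp2]
  have hI : Complex.I ≠ 0 := Complex.I_ne_zero
  field_simp
  ring

/-- The Fourier transform of a compactly supported radial function with first order singularity. -/
theorem integral_radial_div_mul_cexp_inner {Ψ : ℝ → ℂ} (hΨ : Continuous Ψ) {R : ℝ} (hR : 0 < R)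
    (hz : ∀ t, R ≤ t → Ψ t = 0) (ξ : EuclideanSpace ℝ (Fin 3)) (hξ : ξ ≠ 0) :
    ∫ x : EuclideanSpace ℝ (Fin 3), Ψ ‖x‖ / (4 * π * ‖x‖) *
        Complex.exp (-(Complex.I * (inner ℝ ξ x : ℝ))) =
      1 / (2 * Complex.I * ‖ξ‖) *
        ((∫ t in (0 : ℝ)..R, Ψ t * Complex.exp (Complex.I * ‖ξ‖ * t)) -
          ∫ t in (0 : ℝ)..R, Ψ t * Complex.exp (-(Complex.I * ‖ξ‖ * t))) := by
  rw [← integral_radial_div_mul_cexp hΨ hR hz (norm_ne_zero_iff.2 hξ)]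
  let v : EuclideanSpace ℝ (Fin 3) := ‖ξ‖ • EuclideanSpace.single 2 1
  have hv : ‖ξ‖ = ‖v‖ := by simp [v, norm_smul]
  let T : EuclideanSpace ℝ (Fin 3) ≃ₗᵢ[ℝ] EuclideanSpace ℝ (Fin 3) := (ℝ ∙ (ξ - v))ᗮ.reflection
  have hT : T ξ = v := Submodule.reflection_sub hv
  have := T.measurePreserving.integral_comp T.toHomeomorph.measurableEmbedding
    (fun x : EuclideanSpace ℝ (Fin 3) => Ψ ‖x‖ / (4 * π * ‖x‖) *
      Complex.exp (-(Complex.I * ‖ξ‖ * x 2)))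
  rw [← this]
  congr 1; ext x
  have h1 : inner ℝ ξ x = ‖ξ‖ * T x 2 := by
    rw [← T.inner_map_map, hT]
    simp [v, inner_smul_left, EuclideanSpace.inner_single_left]
  rw [h1, T.norm_map]
  push_cast
  ring_nf

theorem summable_one_add_abs_int_rpow {s : ℝ} (hs : 1 < s) :
    Summable fun n : ℤ => (1 + |(n : ℝ)|) ^ (-s) := by
  refine (Real.summable_abs_int_rpow hs).of_norm_bounded_eventually ?_
  have : {n : ℤ | n ≠ 0} ∈ Filter.cofinite := (Set.finite_singleton (0 : ℤ)).compl_mem_cofinite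
  filter_upwards [this] with n hn
  have hn' : 0 < |(n : ℝ)| := by positivity
  rw [Real.norm_of_nonneg (by positivity)]
  exact Real.rpow_le_rpow_of_nonpos hn' (by linarith) (by linarith)

theorem summable_planeWeight : Summable fun n : ℤ × ℤ =>
    (1 + |(n.1 : ℝ)|) ^ (-(5 / 4 : ℝ)) * (1 + |(n.2 : ℝ)|) ^ (-(5 / 4 : ℝ)) :=
  (summable_one_add_abs_int_rpow (by norm_num)).mul_of_nonneg
    (summable_one_add_abs_int_rpow (by norm_num)) (fun _ => by positivity) fun _ => by positivity

theorem summable_spaceWeight : Summable fun j : ℤ × ℤ × ℤ =>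
    (1 + |(j.1 : ℝ)|) ^ (-(5 / 4 : ℝ)) * ((1 + |(j.2.1 : ℝ)|) ^ (-(5 / 4 : ℝ)) *
      (1 + |(j.2.2 : ℝ)|) ^ (-(3 / 2 : ℝ))) :=
  (summable_one_add_abs_int_rpow (by norm_num)).mul_of_nonneg
    ((summable_one_add_abs_int_rpow (by norm_num)).mul_of_nonneg
      (summable_one_add_abs_int_rpow (by norm_num)) (fun _ => by positivity)
      fun _ => by positivity) (fun _ => by positivity) fun _ => by positivity

theorem inv_cube_le_planeWeight {a b : ℝ} (ha : 0 ≤ a) (hb : 0 ≤ b) :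
    1 / (1 + a + b) ^ 3 ≤ (1 + a) ^ (-(5 / 4 : ℝ)) * (1 + b) ^ (-(5 / 4 : ℝ)) := by
  rw [Real.rpow_neg (by positivity), Real.rpow_neg (by positivity), ← mul_inv, ← one_div]
  apply one_div_le_one_div_of_le (by positivity)
  have hu : 1 ≤ 1 + a + b := by linarith
  calc (1 + a) ^ (5 / 4 : ℝ) * (1 + b) ^ (5 / 4 : ℝ)
      ≤ (1 + a + b) ^ (5 / 4 : ℝ) * (1 + a + b) ^ (5 / 4 : ℝ) :=
        mul_le_mul (Real.rpow_le_rpow (by linarith) (by linarith) (by norm_num))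
          (Real.rpow_le_rpow (by linarith) (by linarith) (by norm_num)) (by positivity)
          (by positivity)
    _ = (1 + a + b) ^ (5 / 2 : ℝ) := by
        rw [← Real.rpow_add (by linarith)]; norm_num
    _ ≤ (1 + a + b) ^ (3 : ℝ) := Real.rpow_le_rpow_of_exponent_le hu (by norm_num)
    _ = (1 + a + b) ^ 3 := by norm_cast

theorem inv_le_spaceWeight {a b d : ℝ} (ha : 0 ≤ a) (hb : 0 ≤ b) (hd : 0 ≤ d) :
    1 / ((1 + a + b) * (1 + a + b + d) ^ 3) ≤
      (1 + a) ^ (-(5 / 4 : ℝ)) * ((1 + b) ^ (-(5 / 4 : ℝ)) * (1 + d) ^ (-(3 / 2 : ℝ))) := by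
  rw [Real.rpow_neg (by positivity), Real.rpow_neg (by positivity), Real.rpow_neg (by positivity),
    ← mul_inv, ← mul_inv, ← one_div]
  apply one_div_le_one_div_of_le (by positivity)
  have hu : 0 < 1 + a + b := by linarith
  have hv : 0 < 1 + a + b + d := by linarith
  calc (1 + a) ^ (5 / 4 : ℝ) * ((1 + b) ^ (5 / 4 : ℝ) * (1 + d) ^ (3 / 2 : ℝ))
      ≤ (1 + a + b) ^ (5 / 4 : ℝ) * ((1 + a + b) ^ (5 / 4 : ℝ) *
          (1 + a + b + d) ^ (3 / 2 : ℝ)) :=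
        mul_le_mul (Real.rpow_le_rpow (by linarith) (by linarith) (by norm_num))
          (mul_le_mul (Real.rpow_le_rpow (by linarith) (by linarith) (by norm_num))
            (Real.rpow_le_rpow (by linarith) (by linarith) (by norm_num)) (by positivity)
            (by positivity)) (by positivity) (by positivity)
    _ = (1 + a + b) * ((1 + a + b) ^ (3 / 2 : ℝ) * (1 + a + b + d) ^ (3 / 2 : ℝ)) := by
        have h1 : (1 + a + b) ^ (5 / 4 : ℝ) * (1 + a + b) ^ (5 / 4 : ℝ) =
            (1 + a + b) * (1 + a + b) ^ (3 / 2 : ℝ) := by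
          rw [← Real.rpow_add hu]
          nth_rewrite 2 [← Real.rpow_one (1 + a + b)]
          rw [← Real.rpow_add hu]; norm_num
        rw [← mul_assoc, h1, mul_assoc]
    _ ≤ (1 + a + b) * ((1 + a + b + d) ^ (3 / 2 : ℝ) * (1 + a + b + d) ^ (3 / 2 : ℝ)) :=
        mul_le_mul_of_nonneg_left (mul_le_mul_of_nonneg_right
          (Real.rpow_le_rpow (by linarith) (by linarith) (by norm_num)) (by positivity)) hu.le
    _ = (1 + a + b) * (1 + a + b + d) ^ 3 := by
        rw [← Real.rpow_add hv]; norm_num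

section Beta

variable {k α₁ α₂ : ℝ}

theorem betaCoef3_sq (n : ℤ × ℤ) : betaCoef3 k α₁ α₂ n ^ 2 =
    ((k ^ 2 - ((α₁ + n.1) ^ 2 + (α₂ + n.2) ^ 2) : ℝ) : ℂ) := by
  unfold betaCoef3
  split_ifs with h
  · rw [← Complex.ofReal_pow, Real.sq_sqrt (by linarith)]; congr 1; ring
  · rw [mul_pow, Complex.I_sq, ← Complex.ofReal_pow, Real.sq_sqrt (by linarith)]
    push_cast; ring

theorem betaCoef3_cases (n : ℤ × ℤ) :
    ((betaCoef3 k α₁ α₂ n).im = 0 ∧ (α₁ + n.1) ^ 2 + (α₂ + n.2) ^ 2 ≤ k ^ 2) ∨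
    ((betaCoef3 k α₁ α₂ n).re = 0 ∧ 0 ≤ (betaCoef3 k α₁ α₂ n).im) := by
  unfold betaCoef3
  split_ifs with h
  · left; exact ⟨by simp, h⟩
  · right; exact ⟨by simp, by simp⟩

theorem betaCoef3_im_nonneg (n : ℤ × ℤ) : 0 ≤ (betaCoef3 k α₁ α₂ n).im := by
  rcases betaCoef3_cases (k := k) (α₁ := α₁) (α₂ := α₂) n with h | h
  · exact h.1.ge
  · exact h.2

theorem norm_betaCoef3_sq (n : ℤ × ℤ) : ‖betaCoef3 k α₁ α₂ n‖ ^ 2 =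
    |k ^ 2 - ((α₁ + n.1) ^ 2 + (α₂ + n.2) ^ 2)| := by
  rw [← norm_pow, betaCoef3_sq, Complex.norm_real, Real.norm_eq_abs]

theorem norm_betaCoef3_le_of_im_eq_zero {n : ℤ × ℤ} (hk : 0 < k)
    (h : (α₁ + n.1) ^ 2 + (α₂ + n.2) ^ 2 ≤ k ^ 2) : ‖betaCoef3 k α₁ α₂ n‖ ≤ k := by
  apply le_of_sq_le_sq _ hk.le
  rw [norm_betaCoef3_sq, abs_of_nonneg (by linarith)]
  nlinarith [sq_nonneg (α₁ + n.1), sq_nonneg (α₂ + n.2)]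

theorem exists_linear_le_norm_betaCoef3 {b : ℝ} (hb : 0 < b)
    (hβ : ∀ n : ℤ × ℤ, b ≤ ‖betaCoef3 k α₁ α₂ n‖) :
    ∃ κ : ℝ, 0 < κ ∧ ∀ n : ℤ × ℤ, κ * (1 + |(n.1 : ℝ)| + |(n.2 : ℝ)|) ≤ ‖betaCoef3 k α₁ α₂ n‖ := by
  set q := 1 + |k| / b with hq
  set D := (1 + |α₁| + |α₂|) / b + 2 * q with hD
  have hq0 : 0 < q := by positivity
  have hD0 : 0 < D := by positivity
  refine ⟨1 / D, by positivity, fun n => ?_⟩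
  rw [one_div, inv_mul_le_iff₀ hD0]
  set B := ‖betaCoef3 k α₁ α₂ n‖
  have hB : b ≤ B := hβ n
  have hB0 : 0 < B := hb.trans_le hB
  have h2 : (α₁ + n.1) ^ 2 + (α₂ + n.2) ^ 2 ≤ (q * B) ^ 2 := by
    have h3 : (α₁ + n.1) ^ 2 + (α₂ + n.2) ^ 2 ≤ B ^ 2 + k ^ 2 := by
      have := neg_abs_le (k ^ 2 - ((α₁ + n.1) ^ 2 + (α₂ + n.2) ^ 2))
      rw [← norm_betaCoef3_sq] at this
      linarith
    have h4 : |k| ≤ |k| / b * B := by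
      rw [div_mul_eq_mul_div, le_div_iff₀ hb]; gcongr
    have h5 : q * B = B + |k| / b * B := by rw [hq]; ring
    rw [h5]
    refine h3.trans ?_
    have h6 : k ^ 2 ≤ (|k| / b * B) ^ 2 := by
      rw [← sq_abs k]; exact pow_le_pow_left₀ (abs_nonneg k) h4 2
    have h7 : 0 ≤ |k| / b * B := by positivity
    nlinarith
  have ha : |α₁ + n.1| ≤ q * B := abs_le_of_sq_le_sq (by nlinarith [sq_nonneg (α₂ + n.2)])
    (by positivity)
  have hb' : |α₂ + n.2| ≤ q * B := abs_le_of_sq_le_sq (by nlinarith [sq_nonneg (α₁ + n.1)])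
    (by positivity)
  have e1 : |(n.1 : ℝ)| ≤ |α₁ + n.1| + |α₁| := by
    have := abs_sub (α₁ + n.1) α₁; rwa [add_sub_cancel_left] at this
  have e2 : |(n.2 : ℝ)| ≤ |α₂ + n.2| + |α₂| := by
    have := abs_sub (α₂ + n.2) α₂; rwa [add_sub_cancel_left] at this
  have e3 : 1 + |α₁| + |α₂| ≤ (1 + |α₁| + |α₂|) / b * B := by
    rw [div_mul_eq_mul_div, le_div_iff₀ hb]; gcongr
  have e4 : D * B = (1 + |α₁| + |α₂|) / b * B + 2 * (q * B) := by rw [hD]; ring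
  rw [e4]; linarith

theorem summable_inv_norm_betaCoef3_cube {b : ℝ} (hb : 0 < b)
    (hβ : ∀ n : ℤ × ℤ, b ≤ ‖betaCoef3 k α₁ α₂ n‖) :
    Summable fun n : ℤ × ℤ => 1 / ‖betaCoef3 k α₁ α₂ n‖ ^ 3 := by
  obtain ⟨κ, hκ, h⟩ := exists_linear_le_norm_betaCoef3 hb hβ
  refine Summable.of_nonneg_of_le (fun n => by positivity) (fun n => ?_)
    (summable_planeWeight.mul_left (1 / κ ^ 3))
  calc 1 / ‖betaCoef3 k α₁ α₂ n‖ ^ 3 ≤ 1 / (κ * (1 + |(n.1 : ℝ)| + |(n.2 : ℝ)|)) ^ 3 := by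
        gcongr; exact h n
    _ = 1 / κ ^ 3 * (1 / (1 + |(n.1 : ℝ)| + |(n.2 : ℝ)|) ^ 3) := by
        rw [mul_pow]; field_simp
    _ ≤ _ := by
        gcongr
        exact inv_cube_le_planeWeight (abs_nonneg _) (abs_nonneg _)

/-- Decay of the evanescent modes away from the plane `x₃ = 0`. -/
theorem exp_neg_im_betaCoef3_le (hk : 0 < k) {b : ℝ} (hb : 0 < b)
    (hβ : ∀ n : ℤ × ℤ, b ≤ ‖betaCoef3 k α₁ α₂ n‖) {δ : ℝ} (hδ : 0 < δ) (n : ℤ × ℤ) {t : ℝ}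
    (ht : δ ≤ t) :
    Real.exp (-((betaCoef3 k α₁ α₂ n).im * t)) ≤
      (k ^ 2 + 2 / δ ^ 2) / ‖betaCoef3 k α₁ α₂ n‖ ^ 2 := by
  have hB : 0 < ‖betaCoef3 k α₁ α₂ n‖ := hb.trans_le (hβ n)
  rw [le_div_iff₀ (by positivity)]
  rcases betaCoef3_cases (k := k) (α₁ := α₁) (α₂ := α₂) n with ⟨h, h'⟩ | ⟨h, h'⟩
  · rw [h]
    have := norm_betaCoef3_le_of_im_eq_zero hk h'
    simp only [zero_mul, neg_zero, Real.exp_zero, one_mul]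
    have h3 : ‖betaCoef3 k α₁ α₂ n‖ ^ 2 ≤ k ^ 2 := by gcongr
    have : 0 ≤ 2 / δ ^ 2 := by positivity
    linarith
  · have hn : ‖betaCoef3 k α₁ α₂ n‖ = (betaCoef3 k α₁ α₂ n).im := by
      rw [← Complex.re_add_im (betaCoef3 k α₁ α₂ n), h]; simp [abs_of_nonneg h']
    rw [hn]
    set s := (betaCoef3 k α₁ α₂ n).im
    have hmono : Real.exp (-(s * t)) ≤ Real.exp (-(s * δ)) := by
      apply Real.exp_le_exp.2; nlinarith
    have hq := Real.quadratic_le_exp_of_nonneg (x := s * δ) (by positivity)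
    have hinv : Real.exp (-(s * δ)) * Real.exp (s * δ) = 1 := by
      rw [← Real.exp_add]; simp
    have h5 : Real.exp (-(s * δ)) * ((s * δ) ^ 2 / 2) ≤ 1 := by
      rw [← hinv]
      gcongr
      nlinarith [mul_nonneg h' hδ.le]
    have h6 : Real.exp (-(s * δ)) * s ^ 2 ≤ 2 / δ ^ 2 := by
      rw [le_div_iff₀ (by positivity)]
      nlinarith
    have h7 : Real.exp (-(s * t)) * s ^ 2 ≤ Real.exp (-(s * δ)) * s ^ 2 := by gcongr
    nlinarith [sq_nonneg k]

theorem half_le_norm_betaCoef3_add (hk : 0 < k) (n : ℤ × ℤ) {ω r : ℝ} (hr : 4 * k ≤ r)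
    (hr2 : r ^ 2 = (α₁ + n.1) ^ 2 + (α₂ + n.2) ^ 2 + ω ^ 2) :
    r / 2 ≤ ‖betaCoef3 k α₁ α₂ n + ω‖ := by
  have hr0 : 0 < r := by linarith
  rcases betaCoef3_cases (k := k) (α₁ := α₁) (α₂ := α₂) n with ⟨h, h'⟩ | ⟨h, h'⟩
  · have h1 := norm_betaCoef3_le_of_im_eq_zero hk h'
    have h2 : 3 / 4 * r ≤ |ω| := by
      apply le_of_sq_le_sq _ (abs_nonneg _)
      rw [sq_abs]; nlinarith
    have h3 := norm_sub_norm_le (ω : ℂ) (-betaCoef3 k α₁ α₂ n)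
    rw [Complex.norm_real, Real.norm_eq_abs, norm_neg, sub_neg_eq_add, add_comm (ω : ℂ)] at h3
    linarith
  · apply le_of_sq_le_sq _ (norm_nonneg _)
    have h1 : ‖betaCoef3 k α₁ α₂ n + ω‖ ^ 2 = (betaCoef3 k α₁ α₂ n).im ^ 2 + ω ^ 2 := by
      rw [Complex.sq_norm, Complex.normSq_apply]; simp [h]; ring
    have h2 : (betaCoef3 k α₁ α₂ n).im ^ 2 =
        |k ^ 2 - ((α₁ + n.1) ^ 2 + (α₂ + n.2) ^ 2)| := by
      rw [← norm_betaCoef3_sq, Complex.sq_norm, Complex.normSq_apply]; simp [h]; ring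
    rw [h1, h2]
    have h3 := neg_abs_le (k ^ 2 - ((α₁ + n.1) ^ 2 + (α₂ + n.2) ^ 2))
    nlinarith

/-- Mean square bound for the modes across the plane `x₃ = 0`. -/
theorem integral_exp_neg_im_betaCoef3_le (hk : 0 < k) {b : ℝ} (hb : 0 < b)
    (hβ : ∀ n : ℤ × ℤ, b ≤ ‖betaCoef3 k α₁ α₂ n‖) {R : ℝ} (hR : 0 < R) (n : ℤ × ℤ) :
    ∫ t in (0 : ℝ)..R, Real.exp (-((betaCoef3 k α₁ α₂ n).im * t)) ^ 2 ≤
      (R * k + 1) / ‖betaCoef3 k α₁ α₂ n‖ := by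
  have hB : 0 < ‖betaCoef3 k α₁ α₂ n‖ := hb.trans_le (hβ n)
  rw [le_div_iff₀ hB]
  rcases betaCoef3_cases (k := k) (α₁ := α₁) (α₂ := α₂) n with ⟨h, h'⟩ | ⟨h, h'⟩
  · rw [h]
    have := norm_betaCoef3_le_of_im_eq_zero hk h'
    simp
    nlinarith
  · have hn : ‖betaCoef3 k α₁ α₂ n‖ = (betaCoef3 k α₁ α₂ n).im := by
      rw [← Complex.re_add_im (betaCoef3 k α₁ α₂ n), h]; simp [abs_of_nonneg h']
    rw [hn] at hB ⊢
    set s := (betaCoef3 k α₁ α₂ n).im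
    have h1 : ∀ x ∈ Set.uIcc 0 R, HasDerivAt (fun t : ℝ => -(Real.exp (-(s * t)) ^ 2) / (2 * s))
        (Real.exp (-(s * x)) ^ 2) x := by
      intro x _
      have h0 : HasDerivAt (fun t : ℝ => -(s * t)) (-(s * 1)) x :=
        ((hasDerivAt_id x).const_mul s).neg
      refine (((h0.exp.pow 2).neg).div_const (2 * s)).congr_deriv ?_
      field_simp
      norm_num
      ring
    rw [intervalIntegral.integral_eq_sub_of_hasDerivAt h1
      (Continuous.intervalIntegrable (by fun_prop) _ _)]
    have h2 : 0 ≤ Real.exp (-(s * R)) ^ 2 := by positivity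
    have h3 : 0 ≤ R * k := by positivity
    simp
    field_simp
    linarith
end Beta

/-- The coordinate box `[-R, R] × [-π, π]²`. -/
def coordBox (R : ℝ) : Set (ℝ × (ℝ × ℝ)) :=
  Set.Icc (-R) R ×ˢ (Set.Icc (-π) π ×ˢ Set.Icc (-π) π)

theorem measurableSet_coordBox (R : ℝ) : MeasurableSet (coordBox R) :=
  measurableSet_Icc.prod (measurableSet_Icc.prod measurableSet_Icc)

theorem isCompact_coordBox (R : ℝ) : IsCompact (coordBox R) :=
  isCompact_Icc.prod (isCompact_Icc.prod isCompact_Icc)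

theorem domDd_eq_preimage (R : ℝ) : domDd R = coordSplit ⁻¹' coordBox R := by
  ext x
  simp only [domDd, coordBox, Set.mem_ofPred_eq, Set.mem_preimage, coordSplit_apply, Set.mem_prod]
  tauto

theorem setIntegral_domDd (R : ℝ) (g : ℝ × (ℝ × ℝ) → ℂ) :
    ∫ x in domDd R, g (coordSplit x) = ∫ p in coordBox R, g p := by
  rw [domDd_eq_preimage]
  exact measurePreserving_coordSplit.setIntegral_preimage_emb coordSplit.measurableEmbedding g _

theorem integrableOn_domDd_iff (R : ℝ) (g : ℝ × (ℝ × ℝ) → ℂ) :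
    IntegrableOn (fun x => g (coordSplit x)) (domDd R) ↔ IntegrableOn g (coordBox R) := by
  rw [domDd_eq_preimage]
  exact measurePreserving_coordSplit.integrableOn_comp_preimage coordSplit.measurableEmbedding

/-- A Fourier mode of period `2 R`. -/
def lineMode (R : ℝ) (l : ℤ) (t : ℝ) : ℂ := Complex.exp (Complex.I * (l * π * t / R))

/-- A Fourier mode on the square `[-π, π]²`. -/
def planeMode (n : ℤ × ℤ) (y : ℝ × ℝ) : ℂ :=
  Complex.exp (Complex.I * (n.1 * y.1)) * Complex.exp (Complex.I * (n.2 * y.2))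

@[fun_prop]
theorem continuous_lineMode (R : ℝ) (l : ℤ) : Continuous (lineMode R l) := by
  unfold lineMode; fun_prop

@[fun_prop]
theorem continuous_planeMode (n : ℤ × ℤ) : Continuous (planeMode n) := by
  unfold planeMode; fun_prop

theorem norm_lineMode (R : ℝ) (l : ℤ) (t : ℝ) : ‖lineMode R l t‖ = 1 := by
  rw [lineMode]
  have : (l * π * t / R : ℂ) = ((l * π * t / R : ℝ) : ℂ) := by push_cast; ring
  rw [this, mul_comm, Complex.norm_exp_ofReal_mul_I]

theorem norm_planeMode (n : ℤ × ℤ) (y : ℝ × ℝ) : ‖planeMode n y‖ = 1 := by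
  rw [planeMode, norm_mul]
  have h (l : ℤ) (t : ℝ) : ‖Complex.exp (Complex.I * (l * t))‖ = 1 := by
    have : (l * t : ℂ) = ((l * t : ℝ) : ℂ) := by push_cast; ring
    rw [this, mul_comm, Complex.norm_exp_ofReal_mul_I]
  rw [h, h, one_mul]

theorem lineMode_mul (R : ℝ) (l l' : ℤ) (t : ℝ) :
    lineMode R l t * lineMode R l' t = lineMode R (l + l') t := by
  rw [lineMode, lineMode, lineMode, ← Complex.exp_add]
  congr 1; push_cast; ring

theorem planeMode_mul (n n' : ℤ × ℤ) (y : ℝ × ℝ) :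
    planeMode n y * planeMode n' y = planeMode (n + n') y := by
  simp only [planeMode, Prod.fst_add, Prod.snd_add]
  rw [mul_mul_mul_comm, ← Complex.exp_add, ← Complex.exp_add]
  congr 2 <;> · push_cast; ring

theorem star_planeMode (n : ℤ × ℤ) (y : ℝ × ℝ) :
    (starRingEnd ℂ) (planeMode n y) = planeMode (-n) y := by
  simp [planeMode, ← Complex.exp_conj]

theorem integral_lineMode {R : ℝ} (hR : 0 < R) (l : ℤ) :
    ∫ t in Set.Icc (-R) R, lineMode R l t = if l = 0 then (2 * R : ℂ) else 0 := by
  rw [integral_Icc_eq_integral_Ioc, ← intervalIntegral.integral_of_le (by linarith)]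
  split_ifs with h
  · simp [lineMode, h]; ring
  · have hRC : (R : ℂ) ≠ 0 := by exact_mod_cast hR.ne'
    have hpi : (π : ℂ) ≠ 0 := by exact_mod_cast Real.pi_ne_zero
    have hl : (l : ℂ) ≠ 0 := by exact_mod_cast h
    have hc : Complex.I * l * π / R ≠ 0 := by simp [hRC, hpi, hl]
    have : ∀ t : ℝ, lineMode R l t = Complex.exp (Complex.I * l * π / R * t) := by
      intro t; rw [lineMode]; congr 1; ring
    simp_rw [this]
    rw [integral_exp_mul_complex hc, div_eq_zero_iff]
    left
    rw [sub_eq_zero, Complex.exp_eq_exp_iff_exists_int]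
    refine ⟨l, ?_⟩
    push_cast
    field_simp
    ring

theorem integral_planeMode (n : ℤ × ℤ) :
    ∫ y in Set.Icc (-π) π ×ˢ Set.Icc (-π) π, planeMode n y =
      if n = 0 then (4 * π ^ 2 : ℂ) else 0 := by
  have hpi : (π : ℂ) ≠ 0 := by exact_mod_cast Real.pi_ne_zero
  have h : ∀ y : ℝ × ℝ, planeMode n y = lineMode π n.1 y.1 * lineMode π n.2 y.2 := by
    intro y
    rw [planeMode, lineMode, lineMode]
    congr 2 <;> field_simp
  simp_rw [h]
  rw [Measure.volume_eq_prod, setIntegral_prod_mul, integral_lineMode Real.pi_pos,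
    integral_lineMode Real.pi_pos]
  by_cases h1 : n.1 = 0 <;> by_cases h2 : n.2 = 0 <;> simp [h1, h2, Prod.ext_iff]
  ring

theorem fBasis3_eq (R : ℝ) (j : ℤ × ℤ × ℤ) (x : EuclideanSpace ℝ (Fin 3)) :
    fBasis3 R j x = ((1 / Real.sqrt (8 * π ^ 2 * R) : ℝ) : ℂ) *
      (lineMode R j.2.2 (x 2) * planeMode (j.1, j.2.1) (x 0, x 1)) := by
  rw [fBasis3, lineMode, planeMode, ← Complex.exp_add, ← Complex.exp_add]
  congr 2; ring

theorem norm_fBasis3 (R : ℝ) (j : ℤ × ℤ × ℤ) (x : EuclideanSpace ℝ (Fin 3)) :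
    ‖fBasis3 R j x‖ = 1 / Real.sqrt (8 * π ^ 2 * R) := by
  rw [fBasis3_eq, norm_mul, norm_mul, norm_lineMode, norm_planeMode, Complex.norm_real,
    Real.norm_of_nonneg (by positivity)]
  simp

theorem continuous_fBasis3 (R : ℝ) (j : ℤ × ℤ × ℤ) : Continuous (fBasis3 R j) := by
  unfold fBasis3; fun_prop

theorem integral_fBasis3_mul {R : ℝ} (hR : 0 < R) (i j : ℤ × ℤ × ℤ) :
    ∫ x in domDd R, fBasis3 R i x * fBasis3 R (-j) x = if i = j then 1 else 0 := by
  have hpi : (π : ℂ) ≠ 0 := by exact_mod_cast Real.pi_ne_zero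
  have hRC : (R : ℂ) ≠ 0 := by exact_mod_cast hR.ne'
  have hs : (((1 / Real.sqrt (8 * π ^ 2 * R) : ℝ) : ℂ)) ^ 2 = 1 / (8 * π ^ 2 * R) := by
    rw [← Complex.ofReal_pow, div_pow, Real.sq_sqrt (by positivity)]
    push_cast; ring
  have h : ∀ x : EuclideanSpace ℝ (Fin 3), fBasis3 R i x * fBasis3 R (-j) x =
      (fun p : ℝ × (ℝ × ℝ) => (1 / (8 * π ^ 2 * R) : ℂ) * (lineMode R (i - j).2.2 p.1 *
        planeMode ((i - j).1, (i - j).2.1) p.2)) (coordSplit x) := by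
    intro x
    rw [fBasis3_eq, fBasis3_eq, ← hs]
    have e1 := lineMode_mul R i.2.2 (-j).2.2 (x 2)
    have e2 := planeMode_mul (i.1, i.2.1) ((-j).1, (-j).2.1) (x 0, x 1)
    have e3 : i - j = i + (-j) := sub_eq_add_neg i j
    simp only [coordSplit_apply, e3, Prod.fst_add, Prod.snd_add, Prod.mk_add_mk] at e1 e2 ⊢
    rw [← e1, ← e2]; ring
  simp_rw [h]
  rw [setIntegral_domDd R (fun p : ℝ × (ℝ × ℝ) => (1 / (8 * π ^ 2 * R) : ℂ) *
    (lineMode R (i - j).2.2 p.1 * planeMode ((i - j).1, (i - j).2.1) p.2)), integral_const_mul,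
    coordBox, Measure.volume_eq_prod, setIntegral_prod_mul, integral_lineMode hR,
    integral_planeMode]
  by_cases hij : i = j
  · subst hij
    simp
    field_simp
    ring
  · have : ¬ ((i - j).2.2 = 0 ∧ ((i - j).1, (i - j).2.1) = (0 : ℤ × ℤ)) := by
      rintro ⟨h1, h2⟩
      apply hij
      rw [← sub_eq_zero]
      simp only [Prod.ext_iff] at h2 ⊢
      exact ⟨h2.1, h2.2, h1⟩
    rw [if_neg hij]
    by_cases h1 : (i - j).2.2 = 0
    · rw [if_neg (fun h2 => this ⟨h1, h2⟩)]; simp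
    · rw [if_neg h1]; simp

theorem ae_fst_ne_zero : ∀ᵐ p : ℝ × (ℝ × ℝ), p.1 ≠ 0 := by
  have h : ∀ᵐ z : ℝ, z ≠ 0 := by simp [ae_iff, measure_singleton]
  rw [Measure.volume_eq_prod]
  exact Measure.quasiMeasurePreserving_fst.ae h

section LayeredSeries

variable {R : ℝ} {u : ℤ × ℤ → ℝ → ℂ}

theorem integral_finset_sum_planeMode_sq (hu : ∀ n, Continuous (u n)) (s : Finset (ℤ × ℤ)) :
    ∫ p in coordBox R, ‖∑ n ∈ s, u n p.1 * planeMode n p.2‖ ^ 2 =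
      4 * π ^ 2 * ∑ n ∈ s, ∫ t in Set.Icc (-R) R, ‖u n t‖ ^ 2 := by
  have h1 : ∀ p : ℝ × (ℝ × ℝ), ((‖∑ n ∈ s, u n p.1 * planeMode n p.2‖ ^ 2 : ℝ) : ℂ) =
      ∑ m ∈ s, ∑ n ∈ s, (u n p.1 * (starRingEnd ℂ) (u m p.1)) * planeMode (n - m) p.2 := by
    intro p
    rw [Complex.ofReal_pow, ← Complex.mul_conj', map_sum, Finset.mul_sum]
    refine Finset.sum_congr rfl fun m _ => ?_
    rw [Finset.sum_mul]
    refine Finset.sum_congr rfl fun n _ => ?_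
    rw [map_mul, star_planeMode, sub_eq_add_neg, ← planeMode_mul]; ring
  have h2 : ∀ m n : ℤ × ℤ, IntegrableOn (fun p : ℝ × (ℝ × ℝ) =>
      (u n p.1 * (starRingEnd ℂ) (u m p.1)) * planeMode (n - m) p.2) (coordBox R) := by
    intro m n
    refine ContinuousOn.integrableOn_compact (isCompact_coordBox R) (Continuous.continuousOn ?_)
    have := hu n; have := hu m
    have := Complex.continuous_conj
    fun_prop
  have h3 : ∀ m n : ℤ × ℤ, ∫ p in coordBox R,
      (u n p.1 * (starRingEnd ℂ) (u m p.1)) * planeMode (n - m) p.2 =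
      if n = m then 4 * π ^ 2 * ((∫ t in Set.Icc (-R) R, ‖u n t‖ ^ 2 : ℝ) : ℂ) else 0 := by
    intro m n
    rw [coordBox, Measure.volume_eq_prod]
    refine (setIntegral_prod_mul (fun t => u n t * (starRingEnd ℂ) (u m t))
      (planeMode (n - m)) _ _).trans ?_
    rw [integral_planeMode]
    by_cases h : n = m
    · subst h
      simp only [sub_self, if_true]
      rw [← integral_complex_ofReal, mul_comm]
      congr 2; ext t
      rw [Complex.mul_conj']; push_cast; rfl
    · rw [if_neg (sub_ne_zero.2 h), if_neg h, mul_zero]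
  apply Complex.ofReal_injective
  rw [← integral_complex_ofReal]
  simp_rw [h1]
  rw [integral_finsetSum _ fun m _ => integrable_finsetSum _ fun n _ => h2 m n]
  simp_rw [integral_finsetSum _ fun n _ => h2 _ n, h3]
  simp [Finset.mul_sum]

theorem integrableOn_tsum_planeMode (hu : ∀ n, Continuous (u n))
    (hsq : Summable fun n => ∫ t in Set.Icc (-R) R, ‖u n t‖ ^ 2)
    (hpt : ∀ t, t ≠ 0 → Summable fun n => ‖u n t‖) :
    IntegrableOn (fun p : ℝ × (ℝ × ℝ) => ∑' n, u n p.1 * planeMode n p.2) (coordBox R) := by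
  have hPc : ∀ s : Finset (ℤ × ℤ),
      Continuous fun p : ℝ × (ℝ × ℝ) => ∑ n ∈ s, u n p.1 * planeMode n p.2 := by
    intro s
    have := hu
    fun_prop
  have hlim : ∀ᵐ p ∂(volume.restrict (coordBox R)), Filter.Tendsto
      (fun s : Finset (ℤ × ℤ) => ∑ n ∈ s, u n p.1 * planeMode n p.2) Filter.atTop
      (nhds (∑' n, u n p.1 * planeMode n p.2)) := by
    refine ae_restrict_of_ae ?_
    filter_upwards [ae_fst_ne_zero] with p hp
    have : Summable fun n => u n p.1 * planeMode n p.2 := by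
      apply Summable.of_norm
      simpa [norm_planeMode] using hpt p.1 hp
    exact this.hasSum
  set μ : Measure (ℝ × (ℝ × ℝ)) := volume.restrict (coordBox R)
  have hfin : volume (coordBox R) < ⊤ := (isCompact_coordBox R).measure_lt_top
  have : IsFiniteMeasure μ := ⟨by simpa [μ] using hfin⟩
  set B : ℝ := μ.real Set.univ + 4 * π ^ 2 * ∑' n, ∫ t in Set.Icc (-R) R, ‖u n t‖ ^ 2 with hB
  have hbound : ∀ s : Finset (ℤ × ℤ),
      ∫⁻ p, ‖∑ n ∈ s, u n p.1 * planeMode n p.2‖ₑ ∂μ ≤ ENNReal.ofReal B := by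
    intro s
    have hi : Integrable (fun p : ℝ × (ℝ × ℝ) => ∑ n ∈ s, u n p.1 * planeMode n p.2) μ :=
      (hPc s).continuousOn.integrableOn_compact (isCompact_coordBox R)
    have hi2 : Integrable (fun p : ℝ × (ℝ × ℝ) =>
        ‖∑ n ∈ s, u n p.1 * planeMode n p.2‖ ^ 2) μ :=
      ((hPc s).norm.pow 2).continuousOn.integrableOn_compact (isCompact_coordBox R)
    rw [← ofReal_integral_norm_eq_lintegral_enorm hi]
    apply ENNReal.ofReal_le_ofReal
    calc ∫ p, ‖∑ n ∈ s, u n p.1 * planeMode n p.2‖ ∂μ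
        ≤ ∫ p, (1 + ‖∑ n ∈ s, u n p.1 * planeMode n p.2‖ ^ 2) ∂μ := by
          refine integral_mono hi.norm ((integrable_const 1).add hi2) fun p => ?_
          simp only
          nlinarith [sq_nonneg (‖∑ n ∈ s, u n p.1 * planeMode n p.2‖ - 1),
            norm_nonneg (∑ n ∈ s, u n p.1 * planeMode n p.2)]
      _ = μ.real Set.univ + 4 * π ^ 2 * ∑ n ∈ s, ∫ t in Set.Icc (-R) R, ‖u n t‖ ^ 2 := by
          rw [integral_add (integrable_const 1) hi2, integral_finset_sum_planeMode_sq hu]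
          simp
      _ ≤ B := by
          rw [hB]
          gcongr
          exact hsq.sum_le_tsum s fun n _ => integral_nonneg fun t => by positivity
  refine ⟨aestronglyMeasurable_of_tendsto_ae Filter.atTop
    (fun s => (hPc s).aestronglyMeasurable) hlim, ?_⟩
  calc ∫⁻ p, ‖∑' n, u n p.1 * planeMode n p.2‖ₑ ∂μ
      = ∫⁻ p, Filter.liminf (fun s : Finset (ℤ × ℤ) =>
          ‖∑ n ∈ s, u n p.1 * planeMode n p.2‖ₑ) Filter.atTop ∂μ := by
        apply lintegral_congr_ae
        filter_upwards [hlim] with p hp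
        exact hp.enorm.liminf_eq.symm
    _ ≤ Filter.liminf (fun s : Finset (ℤ × ℤ) =>
          ∫⁻ p, ‖∑ n ∈ s, u n p.1 * planeMode n p.2‖ₑ ∂μ) Filter.atTop :=
        lintegral_liminf_le fun s => (hPc s).measurable.enorm
    _ ≤ ENNReal.ofReal B := by
        refine (Filter.liminf_le_liminf (Filter.Eventually.of_forall hbound)).trans ?_
        simp
    _ < ⊤ := ENNReal.ofReal_lt_top

theorem integral_tsum_planeMode_mul (hu : ∀ n, Continuous (u n))
    (hsq : Summable fun n => ∫ t in Set.Icc (-R) R, ‖u n t‖ ^ 2)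
    (hpt : ∀ t, t ≠ 0 → Summable fun n => ‖u n t‖) {ψ : ℝ → ℂ} (hψ : Continuous ψ)
    {c : ℝ} (hψc : ∀ t, ‖ψ t‖ ≤ c) (m : ℤ × ℤ) :
    ∫ p in coordBox R, (∑' n, u n p.1 * planeMode n p.2) * (ψ p.1 * planeMode (-m) p.2) =
      4 * π ^ 2 * ∫ t in Set.Icc (-R) R, u m t * ψ t := by
  have hint : IntegrableOn (fun p : ℝ × (ℝ × ℝ) =>
      (∑' n, u n p.1 * planeMode n p.2) * (ψ p.1 * planeMode (-m) p.2)) (coordBox R) := by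
    refine (integrableOn_tsum_planeMode hu hsq hpt).mul_bdd (c := c) ?_ (ae_of_all _ fun p => ?_)
    · exact Continuous.aestronglyMeasurable (by fun_prop)
    · rw [norm_mul, norm_planeMode, mul_one]; exact hψc _
  rw [coordBox, Measure.volume_eq_prod] at hint ⊢
  rw [setIntegral_prod _ hint, ← integral_const_mul]
  apply integral_congr_ae
  have h0 : ∀ᵐ z : ℝ, z ≠ 0 := by simp [ae_iff, measure_singleton]
  filter_upwards [ae_restrict_of_ae h0] with t ht
  set Q : Set (ℝ × ℝ) := Set.Icc (-π) π ×ˢ Set.Icc (-π) π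
  have hQ : IsCompact Q := isCompact_Icc.prod isCompact_Icc
  have e1 : ∀ n (y : ℝ × ℝ), u n t * planeMode n y * (ψ t * planeMode (-m) y) =
      u n t * ψ t * planeMode (n - m) y := by
    intro n y
    rw [sub_eq_add_neg, ← planeMode_mul]; ring
  have hF : ∀ n, Integrable (fun y => u n t * ψ t * planeMode (n - m) y) (volume.restrict Q) :=
    fun n => (Continuous.continuousOn (by fun_prop)).integrableOn_compact hQ
  have hS : Summable fun n => ∫ y in Q, ‖u n t * ψ t * planeMode (n - m) y‖ := by
    simp_rw [norm_mul, norm_planeMode, mul_one, integral_const]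
    exact ((hpt t ht).mul_right ‖ψ t‖).const_smul _
  have := hasSum_integral_of_summable_integral_norm hF hS
  calc ∫ y in Q, (∑' n, u n t * planeMode n y) * (ψ t * planeMode (-m) y)
      = ∫ y in Q, ∑' n, u n t * ψ t * planeMode (n - m) y := by
        congr 1; ext y
        rw [← tsum_mul_right]
        simp_rw [e1]
    _ = ∑' n, ∫ y in Q, u n t * ψ t * planeMode (n - m) y := this.tsum_eq.symm
    _ = ∑' n, if n = m then u n t * ψ t * (4 * π ^ 2) else 0 := by
        congr 1; ext n
        rw [integral_const_mul, integral_planeMode]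
        simp [sub_eq_zero]
    _ = 4 * π ^ 2 * (u m t * ψ t) := by
        rw [tsum_eq_single m (by intro n hn; simp [hn])]
        simp; ring

end LayeredSeries

section CutoffGreen

/-- The vertical profile of the `n`-th mode of the truncated Green's function. -/
def greenLayer (k α₁ α₂ : ℝ) (𝒳 : ℝ → ℝ) (n : ℤ × ℤ) (t : ℝ) : ℂ :=
  Complex.I / (8 * (π : ℂ) ^ 2) / betaCoef3 k α₁ α₂ n *
    (Complex.exp (Complex.I * betaCoef3 k α₁ α₂ n * ((|t| : ℝ) : ℂ)) * ((𝒳 |t| : ℝ) : ℂ))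

variable {k α₁ α₂ b M : ℝ} {𝒳 : ℝ → ℝ}

theorem funKd_eq_tsum (x : EuclideanSpace ℝ (Fin 3)) : funKd k α₁ α₂ 𝒳 x =
    ∑' n, greenLayer k α₁ α₂ 𝒳 n (x 2) * planeMode n (x 0, x 1) := by
  rw [funKd, greenGd, ← mul_assoc, mul_assoc, ← tsum_mul_right, ← tsum_mul_left]
  congr 1; ext n
  have : Complex.exp (Complex.I * ((α₁ + (n.1 : ℝ) : ℝ) : ℂ) * (x 0 : ℂ) +
        Complex.I * ((α₂ + (n.2 : ℝ) : ℝ) : ℂ) * (x 1 : ℂ) +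
        Complex.I * betaCoef3 k α₁ α₂ n * ((|x 2| : ℝ) : ℂ)) =
      Complex.exp (-(-Complex.I * (α₁ : ℂ) * (x 0 : ℂ) - Complex.I * (α₂ : ℂ) * (x 1 : ℂ))) *
      (Complex.exp (Complex.I * betaCoef3 k α₁ α₂ n * ((|x 2| : ℝ) : ℂ)) *
        planeMode n (x 0, x 1)) := by
    rw [planeMode, ← Complex.exp_add, ← Complex.exp_add, ← Complex.exp_add]
    congr 1; push_cast; ring
  rw [this, Complex.exp_neg, greenLayer]
  field_simp [Complex.exp_ne_zero]

theorem continuous_greenLayer (h𝒳 : Continuous 𝒳) (n : ℤ × ℤ) :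
    Continuous (greenLayer k α₁ α₂ 𝒳 n) := by
  unfold greenLayer; fun_prop

theorem norm_greenLayer_le (hM : ∀ t, |𝒳 t| ≤ M) (n : ℤ × ℤ) (t : ℝ) :
    ‖greenLayer k α₁ α₂ 𝒳 n t‖ ≤
      M / ‖betaCoef3 k α₁ α₂ n‖ * Real.exp (-((betaCoef3 k α₁ α₂ n).im * |t|)) := by
  have hre : (Complex.I * betaCoef3 k α₁ α₂ n * ((|t| : ℝ) : ℂ)).re =
      -((betaCoef3 k α₁ α₂ n).im * |t|) := by
    simp [Complex.mul_re, Complex.mul_im]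
  have h8 : ‖Complex.I / (8 * (π : ℂ) ^ 2)‖ ≤ 1 := by
    have : ‖Complex.I / (8 * (π : ℂ) ^ 2)‖ = 1 / (8 * π ^ 2) := by
      simp [abs_of_pos Real.pi_pos]
    rw [this, div_le_one (by positivity)]
    nlinarith [Real.pi_gt_three]
  have hM0 : 0 ≤ M := (abs_nonneg _).trans (hM 0)
  rw [greenLayer, norm_mul, norm_div, norm_mul, Complex.norm_exp, hre, Complex.norm_real,
    Real.norm_eq_abs]
  calc _ ≤ 1 / ‖betaCoef3 k α₁ α₂ n‖ * (Real.exp (-((betaCoef3 k α₁ α₂ n).im * |t|)) * M) := by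
        gcongr; exact hM _
    _ = _ := by ring

theorem norm_greenLayer_le_inv_cube (hk : 0 < k) (hb : 0 < b)
    (hβ : ∀ n : ℤ × ℤ, b ≤ ‖betaCoef3 k α₁ α₂ n‖) (hM : ∀ t, |𝒳 t| ≤ M) {δ : ℝ} (hδ : 0 < δ)
    (n : ℤ × ℤ) {t : ℝ} (ht : δ ≤ |t|) :
    ‖greenLayer k α₁ α₂ 𝒳 n t‖ ≤
      M * (k ^ 2 + 2 / δ ^ 2) * (1 / ‖betaCoef3 k α₁ α₂ n‖ ^ 3) := by
  have hM0 : 0 ≤ M := (abs_nonneg _).trans (hM 0)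
  have hB : 0 < ‖betaCoef3 k α₁ α₂ n‖ := hb.trans_le (hβ n)
  refine (norm_greenLayer_le hM n t).trans ?_
  calc _ ≤ M / ‖betaCoef3 k α₁ α₂ n‖ * ((k ^ 2 + 2 / δ ^ 2) / ‖betaCoef3 k α₁ α₂ n‖ ^ 2) := by
        gcongr
        exact exp_neg_im_betaCoef3_le hk hb hβ hδ n ht
    _ = _ := by field_simp

theorem summable_norm_greenLayer (hk : 0 < k) (hb : 0 < b)
    (hβ : ∀ n : ℤ × ℤ, b ≤ ‖betaCoef3 k α₁ α₂ n‖) (hM : ∀ t, |𝒳 t| ≤ M) (t : ℝ) (ht : t ≠ 0) :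
    Summable fun n => ‖greenLayer k α₁ α₂ 𝒳 n t‖ :=
  Summable.of_nonneg_of_le (fun _ => norm_nonneg _)
    (fun n => norm_greenLayer_le_inv_cube hk hb hβ hM (abs_pos.2 ht) n le_rfl)
    ((summable_inv_norm_betaCoef3_cube hb hβ).mul_left _)

theorem summable_integral_norm_greenLayer_sq (hk : 0 < k) (hb : 0 < b)
    (hβ : ∀ n : ℤ × ℤ, b ≤ ‖betaCoef3 k α₁ α₂ n‖) (h𝒳 : Continuous 𝒳) (hM : ∀ t, |𝒳 t| ≤ M)
    {R : ℝ} (hR : 0 < R) :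
    Summable fun n => ∫ t in Set.Icc (-R) R, ‖greenLayer k α₁ α₂ 𝒳 n t‖ ^ 2 := by
  refine Summable.of_nonneg_of_le (fun n => integral_nonneg fun t => by positivity) (fun n => ?_)
    ((summable_inv_norm_betaCoef3_cube hb hβ).mul_left (2 * M ^ 2 * (R * k + 1)))
  have hM0 : 0 ≤ M := (abs_nonneg _).trans (hM 0)
  have hB : 0 < ‖betaCoef3 k α₁ α₂ n‖ := hb.trans_le (hβ n)
  rw [integral_Icc_eq_integral_Ioc, ← intervalIntegral.integral_of_le (by linarith)]
  have hc := continuous_greenLayer (k := k) (α₁ := α₁) (α₂ := α₂) h𝒳 n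
  calc ∫ t in (-R)..R, ‖greenLayer k α₁ α₂ 𝒳 n t‖ ^ 2
      = 2 * ∫ t in (0 : ℝ)..R, ‖greenLayer k α₁ α₂ 𝒳 n t‖ ^ 2 := by
        have hi : ∀ a b, IntervalIntegrable (fun t => ‖greenLayer k α₁ α₂ 𝒳 n t‖ ^ 2)
            volume a b := fun a b => (hc.norm.pow 2).intervalIntegrable a b
        rw [← intervalIntegral.integral_add_adjacent_intervals (hi (-R) 0) (hi 0 R), two_mul]
        congr 1
        have := intervalIntegral.integral_comp_neg (a := 0) (b := R)
          (fun t => ‖greenLayer k α₁ α₂ 𝒳 n t‖ ^ 2)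
        rw [neg_zero] at this
        rw [← this]
        simp [greenLayer]
    _ ≤ 2 * ∫ t in (0 : ℝ)..R, (M / ‖betaCoef3 k α₁ α₂ n‖) ^ 2 *
          Real.exp (-((betaCoef3 k α₁ α₂ n).im * t)) ^ 2 := by
        gcongr
        refine intervalIntegral.integral_mono_on hR.le
          ((hc.norm.pow 2).intervalIntegrable _ _)
          (Continuous.intervalIntegrable (by fun_prop) _ _) fun t ht => ?_
        rw [← mul_pow]
        have := norm_greenLayer_le (k := k) (α₁ := α₁) (α₂ := α₂) hM n t
        rw [abs_of_nonneg ht.1] at this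
        gcongr
    _ ≤ 2 * ((M / ‖betaCoef3 k α₁ α₂ n‖) ^ 2 * ((R * k + 1) / ‖betaCoef3 k α₁ α₂ n‖)) := by
        rw [intervalIntegral.integral_const_mul]
        gcongr
        exact integral_exp_neg_im_betaCoef3_le hk hb hβ hR n
    _ = _ := by field_simp

theorem integrableOn_funKd (hk : 0 < k) (hb : 0 < b)
    (hβ : ∀ n : ℤ × ℤ, b ≤ ‖betaCoef3 k α₁ α₂ n‖) (h𝒳 : Continuous 𝒳) (hM : ∀ t, |𝒳 t| ≤ M)
    {R : ℝ} (hR : 0 < R) : IntegrableOn (funKd k α₁ α₂ 𝒳) (domDd R) := by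
  have := (integrableOn_domDd_iff R _).2 (integrableOn_tsum_planeMode
    (continuous_greenLayer (k := k) (α₁ := α₁) (α₂ := α₂) h𝒳)
    (summable_integral_norm_greenLayer_sq hk hb hβ h𝒳 hM hR)
    (summable_norm_greenLayer hk hb hβ hM))
  refine this.congr_fun (fun x _ => ?_) ?_
  · simp [funKd_eq_tsum, coordSplit_apply]
  · rw [domDd_eq_preimage]; exact coordSplit.measurable (measurableSet_coordBox R)

theorem fourierCoef3_funKd (hk : 0 < k) (hb : 0 < b)
    (hβ : ∀ n : ℤ × ℤ, b ≤ ‖betaCoef3 k α₁ α₂ n‖) (h𝒳 : Continuous 𝒳) (hM : ∀ t, |𝒳 t| ≤ M)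
    {R : ℝ} (hR : 0 < R) (j : ℤ × ℤ × ℤ) :
    fourierCoef3 R (funKd k α₁ α₂ 𝒳) j = ((1 / Real.sqrt (8 * π ^ 2 * R) : ℝ) : ℂ) *
      (Complex.I / (2 * betaCoef3 k α₁ α₂ (j.1, j.2.1)) *
        ((∫ t in (0 : ℝ)..R, (𝒳 t : ℂ) * Complex.exp
            (Complex.I * (betaCoef3 k α₁ α₂ (j.1, j.2.1) - ((j.2.2 * π / R : ℝ) : ℂ)) * t)) +
          ∫ t in (0 : ℝ)..R, (𝒳 t : ℂ) * Complex.exp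
            (Complex.I * (betaCoef3 k α₁ α₂ (j.1, j.2.1) + ((j.2.2 * π / R : ℝ) : ℂ)) * t))) := by
  have hpi : (π : ℂ) ≠ 0 := by exact_mod_cast Real.pi_ne_zero
  have hx : ∀ x, funKd k α₁ α₂ 𝒳 x * fBasis3 R (-j) x =
      (fun p : ℝ × (ℝ × ℝ) => ((1 / Real.sqrt (8 * π ^ 2 * R) : ℝ) : ℂ) *
        ((∑' n, greenLayer k α₁ α₂ 𝒳 n p.1 * planeMode n p.2) *
          (lineMode R (-j.2.2) p.1 * planeMode (-(j.1, j.2.1)) p.2))) (coordSplit x) := by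
    intro x
    rw [funKd_eq_tsum, fBasis3_eq, coordSplit_apply]
    simp only [Prod.fst_neg, Prod.snd_neg, Prod.neg_mk]
    ring
  rw [fourierCoef3]
  simp_rw [hx]
  rw [setIntegral_domDd R (fun p : ℝ × (ℝ × ℝ) => ((1 / Real.sqrt (8 * π ^ 2 * R) : ℝ) : ℂ) *
        ((∑' n, greenLayer k α₁ α₂ 𝒳 n p.1 * planeMode n p.2) *
          (lineMode R (-j.2.2) p.1 * planeMode (-(j.1, j.2.1)) p.2))), integral_const_mul,
    integral_tsum_planeMode_mul (continuous_greenLayer h𝒳)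
    (summable_integral_norm_greenLayer_sq hk hb hβ h𝒳 hM hR)
    (summable_norm_greenLayer hk hb hβ hM) (continuous_lineMode R (-j.2.2))
    (fun t => (norm_lineMode R _ t).le)]
  congr 1
  rw [integral_Icc_eq_integral_Ioc, ← intervalIntegral.integral_of_le (by linarith)]
  set β := betaCoef3 k α₁ α₂ (j.1, j.2.1) with hβdef
  set w : ℝ := j.2.2 * π / R with hw
  have hg : Continuous fun t : ℝ => Complex.exp (Complex.I * β * t) * (𝒳 t : ℂ) := by fun_prop
  have h1 : ∀ t : ℝ, greenLayer k α₁ α₂ 𝒳 (j.1, j.2.1) t * lineMode R (-j.2.2) t =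
      Complex.I / (8 * (π : ℂ) ^ 2) / β *
        ((fun t : ℝ => Complex.exp (Complex.I * β * t) * (𝒳 t : ℂ)) |t| *
          Complex.exp (-(Complex.I * w * t))) := by
    intro t
    rw [greenLayer, lineMode, ← hβdef]
    have : Complex.I * (((-j.2.2 : ℤ) : ℂ) * π * t / R) = -(Complex.I * w * t) := by
      rw [hw]; push_cast; ring
    rw [this]; ring
  simp_rw [h1]
  rw [intervalIntegral.integral_const_mul, integral_abs_mul_cexp hg w]
  have h2 : ∀ s : ℂ, ∫ t in (0 : ℝ)..R, Complex.exp (Complex.I * β * (|t| : ℝ)) * (𝒳 |t| : ℂ) *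
      Complex.exp (s * t) = ∫ t in (0 : ℝ)..R, (𝒳 t : ℂ) * Complex.exp
            ((Complex.I * β + s) * t) := by
    intro s
    refine intervalIntegral.integral_congr fun t ht => ?_
    rw [Set.uIcc_of_le hR.le] at ht
    simp only [abs_of_nonneg ht.1]
    rw [add_mul, Complex.exp_add]; ring
  have h3 := h2 (-(Complex.I * w))
  have h4 := h2 (Complex.I * w)
  simp only [neg_mul] at h3
  rw [h3, h4, ← mul_assoc]
  congr 1
  · field_simp
    ring
  · congr 1 <;> (refine intervalIntegral.integral_congr fun t _ => ?_) <;>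
      (congr 2; ring)

theorem continuousAt_funKd (hk : 0 < k) (hb : 0 < b)
    (hβ : ∀ n : ℤ × ℤ, b ≤ ‖betaCoef3 k α₁ α₂ n‖) (h𝒳 : Continuous 𝒳) (hM : ∀ t, |𝒳 t| ≤ M)
    (x : EuclideanSpace ℝ (Fin 3)) (hx : x 2 ≠ 0) : ContinuousAt (funKd k α₁ α₂ 𝒳) x := by
  have hδ : 0 < |x 2| / 2 := by positivity
  have hopen : IsOpen {y : EuclideanSpace ℝ (Fin 3) | |x 2| / 2 < |y 2|} :=
    isOpen_lt continuous_const (by fun_prop)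
  have hmem : x ∈ {y : EuclideanSpace ℝ (Fin 3) | |x 2| / 2 < |y 2|} := by
    change |x 2| / 2 < |x 2|; linarith
  refine ContinuousOn.continuousAt ?_ (hopen.mem_nhds hmem)
  rw [show funKd k α₁ α₂ 𝒳 = fun x => _ from funext funKd_eq_tsum]
  refine continuousOn_tsum (fun n => Continuous.continuousOn ?_)
    ((summable_inv_norm_betaCoef3_cube hb hβ).mul_left (M * (k ^ 2 + 2 / (|x 2| / 2) ^ 2)))
    fun n y hy => ?_
  · have := continuous_greenLayer (k := k) (α₁ := α₁) (α₂ := α₂) h𝒳 n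
    fun_prop
  · rw [norm_mul, norm_planeMode, mul_one]
    exact norm_greenLayer_le_inv_cube hk hb hβ hM hδ n (le_of_lt hy)

end CutoffGreen

section SingularPart

variable {k α₁ α₂ R ρ : ℝ} {𝒴 : ℝ → ℝ}

/-- The shifted wave vector `(α₁ + j₁, α₂ + j₂, j₃ π / R)`. -/
def waveVec (α₁ α₂ R : ℝ) (j : ℤ × ℤ × ℤ) : EuclideanSpace ℝ (Fin 3) :=
  !₂[α₁ + j.1, α₂ + j.2.1, j.2.2 * π / R]

theorem norm_waveVec_sq (j : ℤ × ℤ × ℤ) : ‖waveVec α₁ α₂ R j‖ ^ 2 =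
    (α₁ + j.1) ^ 2 + (α₂ + j.2.1) ^ 2 + (j.2.2 * π / R) ^ 2 := by
  rw [EuclideanSpace.norm_sq_eq, Fin.sum_univ_three]
  simp only [Real.norm_eq_abs, sq_abs]
  simp [waveVec]

theorem funF3_eq (x : EuclideanSpace ℝ (Fin 3)) : funF3 k α₁ α₂ 𝒴 x =
    Complex.exp (-Complex.I * (α₁ : ℂ) * (x 0 : ℂ) - Complex.I * (α₂ : ℂ) * (x 1 : ℂ)) *
      ((fun t : ℝ => Complex.exp (Complex.I * k * t) * (𝒴 t : ℂ)) ‖x‖ / (4 * π * ‖x‖)) := by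
  rw [funF3]; ring

theorem funF3_eq_zero (h0 : ∀ t, ρ ≤ t → 𝒴 t = 0) {x : EuclideanSpace ℝ (Fin 3)} (hx : ρ ≤ ‖x‖) :
    funF3 k α₁ α₂ 𝒴 x = 0 := by
  simp [funF3, h0 _ hx]

theorem continuousAt_funF3 (h𝒴 : Continuous 𝒴) {x : EuclideanSpace ℝ (Fin 3)} (hx : x ≠ 0) :
    ContinuousAt (funF3 k α₁ α₂ 𝒴) x := by
  have h4 : (4 * (π : ℂ) * (‖x‖ : ℂ)) ≠ 0 := by
    simp [Real.pi_ne_zero, hx]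
  unfold funF3
  refine ContinuousAt.mul (ContinuousAt.mul (by fun_prop) (ContinuousAt.div (by fun_prop)
    (by fun_prop) h4)) (by fun_prop)

theorem norm_exp_quasiMomentum (α₁ α₂ : ℝ) (x : EuclideanSpace ℝ (Fin 3)) :
    ‖Complex.exp (-Complex.I * (α₁ : ℂ) * (x 0 : ℂ) - Complex.I * (α₂ : ℂ) * (x 1 : ℂ))‖ = 1 := by
  rw [Complex.norm_exp]
  simp

theorem integrable_funF3 (h𝒴 : Continuous 𝒴) (h0 : ∀ t, ρ ≤ t → 𝒴 t = 0) :
    Integrable (funF3 k α₁ α₂ 𝒴) := by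
  rw [show funF3 k α₁ α₂ 𝒴 = fun x => _ from funext funF3_eq]
  have hΨ : Continuous fun t : ℝ => Complex.exp (Complex.I * k * t) * (𝒴 t : ℂ) := by fun_prop
  refine (integrable_radial_div hΨ (R := ρ) fun t ht => ?_).bdd_mul (c := 1) ?_
    (ae_of_all _ fun x => (norm_exp_quasiMomentum α₁ α₂ x).le)
  · simp [h0 t ht]
  · exact Continuous.aestronglyMeasurable (by fun_prop)

theorem abs_coord_le_norm (x : EuclideanSpace ℝ (Fin 3)) (i : Fin 3) : |x i| ≤ ‖x‖ := by
  simpa using PiLp.norm_apply_le x i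

theorem fourierCoef3_funF3 (h𝒴 : Continuous 𝒴) (hρ : 0 < ρ) (hρπ : ρ ≤ π) (hρR : ρ ≤ R)
    (h0 : ∀ t, ρ ≤ t → 𝒴 t = 0) (j : ℤ × ℤ × ℤ) (hj : waveVec α₁ α₂ R j ≠ 0) :
    fourierCoef3 R (funF3 k α₁ α₂ 𝒴) j = ((1 / Real.sqrt (8 * π ^ 2 * R) : ℝ) : ℂ) *
      (1 / (2 * Complex.I * ‖waveVec α₁ α₂ R j‖) *
        ((∫ t in (0 : ℝ)..ρ, (𝒴 t : ℂ) * Complex.exp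
            (Complex.I * ((k + ‖waveVec α₁ α₂ R j‖ : ℝ) : ℂ) * t)) -
          ∫ t in (0 : ℝ)..ρ, (𝒴 t : ℂ) * Complex.exp
            (Complex.I * ((k - ‖waveVec α₁ α₂ R j‖ : ℝ) : ℂ) * t))) := by
  have hx : ∀ x, funF3 k α₁ α₂ 𝒴 x * fBasis3 R (-j) x =
      ((1 / Real.sqrt (8 * π ^ 2 * R) : ℝ) : ℂ) *
        ((fun t : ℝ => Complex.exp (Complex.I * k * t) * (𝒴 t : ℂ)) ‖x‖ / (4 * π * ‖x‖) *
          Complex.exp (-(Complex.I * (inner ℝ (waveVec α₁ α₂ R j) x : ℝ)))) := by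
    intro x
    have : Complex.exp (-(Complex.I * (inner ℝ (waveVec α₁ α₂ R j) x : ℝ))) =
      Complex.exp (-Complex.I * (α₁ : ℂ) * (x 0 : ℂ) - Complex.I * (α₂ : ℂ) * (x 1 : ℂ)) *
      Complex.exp (Complex.I * (((-j).1 : ℂ) * (x 0 : ℂ) + ((-j).2.1 : ℂ) * (x 1 : ℂ) +
      ((-j).2.2 : ℂ) * (π : ℂ) * (x 2 : ℂ) / (R : ℂ))) := by
      rw [← Complex.exp_add]
      congr 1
      simp [PiLp.inner_apply, Fin.sum_univ_three, waveVec]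
      ring
    rw [funF3_eq, fBasis3, this]; ring
  have hout : ∀ x, x ∉ domDd R → funF3 k α₁ α₂ 𝒴 x * fBasis3 R (-j) x = 0 := by
    intro x hx
    rw [funF3_eq_zero h0 ?_, zero_mul]
    by_contra! hlt
    refine hx ⟨abs_le.1 ?_, abs_le.1 ?_, abs_le.1 ?_⟩ <;>
      refine (abs_coord_le_norm x _).trans (hlt.le.trans ?_) <;> assumption
  rw [fourierCoef3, setIntegral_eq_integral_of_forall_compl_eq_zero hout]
  simp_rw [hx]
  have hΨ : Continuous fun t : ℝ => Complex.exp (Complex.I * k * t) * (𝒴 t : ℂ) := by fun_prop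
  have key := integral_radial_div_mul_cexp_inner hΨ hρ (fun t ht => by simp [h0 t ht]) _ hj
  rw [integral_const_mul, key]
  congr 3 <;>
  · refine intervalIntegral.integral_congr fun t _ => ?_
    rw [mul_comm (Complex.exp _) (𝒴 t : ℂ), mul_assoc, ← Complex.exp_add]
    congr 2
    push_cast; ring

end SingularPart

section CoefficientDecay

variable {k α₁ α₂ b M R ρ : ℝ} {𝒳 𝒴 : ℝ → ℝ}

/-- The `ℓ¹` size of a frequency. -/
def freqSize (j : ℤ × ℤ × ℤ) : ℝ := |(j.1 : ℝ)| + |(j.2.1 : ℝ)| + |(j.2.2 : ℝ)|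

theorem freqSize_nonneg (j : ℤ × ℤ × ℤ) : 0 ≤ freqSize j := by unfold freqSize; positivity

theorem norm_sub_le_of_expansions {β : ℂ} {w r : ℝ} (hβ : β ≠ 0) (hr : 4 * k ≤ r) (hk : 0 < k)
    (hβr : ‖β‖ ≤ 2 * r) (hsq : β ^ 2 - (w : ℂ) ^ 2 = (k : ℂ) ^ 2 - (r : ℂ) ^ 2)
    (h1 : r / 2 ≤ ‖β - w‖) (h2 : r / 2 ≤ ‖β + w‖) {A B : ℝ} (hA : 0 < A) (hB : 0 < B) {p : ℕ}
    {J₁ J₂ J₃ J₄ : ℂ}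
    (e1 : ‖J₁ + 1 / (Complex.I * (β - w))‖ ≤ A / ‖Complex.I * (β - w)‖ ^ p)
    (e2 : ‖J₂ + 1 / (Complex.I * (β + w))‖ ≤ A / ‖Complex.I * (β + w)‖ ^ p)
    (e3 : ‖J₃ + 1 / (Complex.I * ((k + r : ℝ) : ℂ))‖ ≤ B / ‖Complex.I * ((k + r : ℝ) : ℂ)‖ ^ p)
    (e4 : ‖J₄ + 1 / (Complex.I * ((k - r : ℝ) : ℂ))‖ ≤ B / ‖Complex.I * ((k - r : ℝ) : ℂ)‖ ^ p) :
    ‖Complex.I / (2 * β) * (J₁ + J₂) - 1 / (2 * Complex.I * r) * (J₃ - J₄)‖ ≤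
      (A + 2 * B) * 2 ^ p / (‖β‖ * r ^ p) := by
  have hr0 : 0 < r := by linarith
  have hB0 : 0 < ‖β‖ := norm_pos_iff.2 hβ
  have hrC : (r : ℂ) ≠ 0 := by exact_mod_cast hr0.ne'
  have n1 : β - w ≠ 0 := norm_pos_iff.1 (by linarith)
  have n2 : β + w ≠ 0 := norm_pos_iff.1 (by linarith)
  have n3 : (k : ℂ) + r ≠ 0 := by exact_mod_cast (by linarith : (0 : ℝ) < k + r).ne'
  have n4 : (k : ℂ) - r ≠ 0 := by exact_mod_cast (by linarith : k - r < (0 : ℝ)).ne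
  have hlead : Complex.I / (2 * β) * (1 / (Complex.I * (β - w)) + 1 / (Complex.I * (β + w))) =
      1 / (2 * Complex.I * r) * (1 / (Complex.I * ((k + r : ℝ) : ℂ)) -
        1 / (Complex.I * ((k - r : ℝ) : ℂ))) := by
    have t1 : Complex.I / (2 * β) * (1 / (Complex.I * (β - w)) + 1 / (Complex.I * (β + w))) =
        1 / (β ^ 2 - (w : ℂ) ^ 2) := by
      rw [sq_sub_sq]; field_simp; ring
    have t2 : 1 / (2 * Complex.I * r) * (1 / (Complex.I * ((k + r : ℝ) : ℂ)) -
        1 / (Complex.I * ((k - r : ℝ) : ℂ))) = 1 / ((k : ℂ) ^ 2 - (r : ℂ) ^ 2) := by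
      rw [sq_sub_sq]; push_cast; field_simp; rw [Complex.I_sq]; ring
    rw [t1, t2, hsq]
  have hsplit : Complex.I / (2 * β) * (J₁ + J₂) - 1 / (2 * Complex.I * r) * (J₃ - J₄) =
      Complex.I / (2 * β) * ((J₁ + 1 / (Complex.I * (β - w))) + (J₂ + 1 / (Complex.I * (β + w)))) -
      1 / (2 * Complex.I * r) * ((J₃ + 1 / (Complex.I * ((k + r : ℝ) : ℂ))) -
        (J₄ + 1 / (Complex.I * ((k - r : ℝ) : ℂ)))) := by
    linear_combination -hlead
  have hpow : ∀ {z : ℂ} {D : ℝ}, 0 < D → r / 2 ≤ ‖z‖ →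
      D / ‖Complex.I * z‖ ^ p ≤ D / (r / 2) ^ p := by
    intro z D hD hz
    rw [norm_mul, Complex.norm_I, one_mul]
    gcongr
  have h3 : r / 2 ≤ ‖((k + r : ℝ) : ℂ)‖ := by
    rw [Complex.norm_real, Real.norm_eq_abs]; exact le_abs.2 (Or.inl (by linarith))
  have h4 : r / 2 ≤ ‖((k - r : ℝ) : ℂ)‖ := by
    rw [Complex.norm_real, Real.norm_eq_abs]; exact le_abs.2 (Or.inr (by linarith))
  have c1 : ‖Complex.I / (2 * β)‖ = 1 / (2 * ‖β‖) := by simp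
  have c2 : ‖1 / (2 * Complex.I * (r : ℂ))‖ = 1 / (2 * r) := by simp [abs_of_pos hr0]
  rw [hsplit]
  calc _ ≤ 1 / (2 * ‖β‖) * (A / (r / 2) ^ p + A / (r / 2) ^ p) +
        1 / (2 * r) * (B / (r / 2) ^ p + B / (r / 2) ^ p) := by
        refine (norm_sub_le _ _).trans (add_le_add ?_ ?_)
        · rw [norm_mul, c1]
          gcongr
          exact (norm_add_le _ _).trans (add_le_add (e1.trans (hpow hA h1)) (e2.trans (hpow hA h2)))
        · rw [norm_mul, c2]
          gcongr
          exact (norm_sub_le _ _).trans (add_le_add (e3.trans (hpow hB h3)) (e4.trans (hpow hB h4)))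
    _ ≤ 1 / (2 * ‖β‖) * (A / (r / 2) ^ p + A / (r / 2) ^ p) +
        1 / ‖β‖ * (B / (r / 2) ^ p + B / (r / 2) ^ p) := by gcongr
    _ = _ := by rw [div_pow]; field_simp; ring

theorem integrableOn_mul_fBasis3 {g : EuclideanSpace ℝ (Fin 3) → ℂ} (hg : IntegrableOn g (domDd R))
    (j : ℤ × ℤ × ℤ) : IntegrableOn (fun x => g x * fBasis3 R j x) (domDd R) :=
  Integrable.mul_bdd hg (continuous_fBasis3 R j).aestronglyMeasurable
    (ae_of_all _ fun x => (norm_fBasis3 R j x).le)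

theorem exists_norm_fourierCoef3_funLd_le (hk : 0 < k) (hb : 0 < b)
    (hβ : ∀ n : ℤ × ℤ, b ≤ ‖betaCoef3 k α₁ α₂ n‖) {p : ℕ} (hp : 0 < p)
    (h𝒳 : ContDiff ℝ p 𝒳) (hM : ∀ t, |𝒳 t| ≤ M) (hR : 0 < R) (h𝒳1 : 𝒳 =ᶠ[nhds 0] fun _ => 1)
    (h𝒳0 : 𝒳 =ᶠ[nhds R] fun _ => 0) (h𝒴 : ContDiff ℝ p 𝒴) (hρ : 0 < ρ) (hρπ : ρ ≤ π)
    (hρR : ρ ≤ R) (h𝒴1 : 𝒴 =ᶠ[nhds 0] fun _ => 1) (h𝒴ρ : 𝒴 =ᶠ[nhds ρ] fun _ => 0)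
    (h𝒴0 : ∀ t, ρ ≤ t → 𝒴 t = 0) :
    ∃ C : ℝ, 0 < C ∧ ∀ j : ℤ × ℤ × ℤ, 4 * k ≤ ‖waveVec α₁ α₂ R j‖ →
      ‖fourierCoef3 R (funLd k α₁ α₂ 𝒳 𝒴) j‖ ≤
        C / (‖betaCoef3 k α₁ α₂ (j.1, j.2.1)‖ * ‖waveVec α₁ α₂ R j‖ ^ p) := by
  obtain ⟨A, hA, hA'⟩ := exists_norm_integral_cutoff_le hp hR h𝒳 h𝒳1 h𝒳0
  obtain ⟨B, hB, hB'⟩ := exists_norm_integral_cutoff_le hp hρ h𝒴 h𝒴1 h𝒴ρ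
  refine ⟨1 / Real.sqrt (8 * π ^ 2 * R) * ((A + 2 * B) * 2 ^ p), by positivity, fun j hj => ?_⟩
  have hξ : waveVec α₁ α₂ R j ≠ 0 := norm_pos_iff.1 (by linarith)
  have hsub : fourierCoef3 R (funLd k α₁ α₂ 𝒳 𝒴) j =
      fourierCoef3 R (funKd k α₁ α₂ 𝒳) j - fourierCoef3 R (funF3 k α₁ α₂ 𝒴) j := by
    rw [fourierCoef3, fourierCoef3, fourierCoef3, ← integral_sub
      (integrableOn_mul_fBasis3 (integrableOn_funKd hk hb hβ h𝒳.continuous hM hR) _)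
      (integrableOn_mul_fBasis3 (integrable_funF3 h𝒴.continuous h𝒴0).integrableOn _)]
    simp only [funLd, sub_mul]
  rw [hsub, fourierCoef3_funKd hk hb hβ h𝒳.continuous hM hR,
    fourierCoef3_funF3 h𝒴.continuous hρ hρπ hρR h𝒴0 j hξ, ← mul_sub, norm_mul, Complex.norm_real,
    Real.norm_of_nonneg (by positivity),
    mul_div_assoc (1 / Real.sqrt (8 * π ^ 2 * R))]
  refine mul_le_mul_of_nonneg_left ?_ (by positivity)
  set n : ℤ × ℤ := (j.1, j.2.1)
  set β := betaCoef3 k α₁ α₂ n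
  set r := ‖waveVec α₁ α₂ R j‖ with hr
  set w : ℝ := j.2.2 * π / R with hw
  have hr0 : 0 < r := by linarith
  have hr2 : r ^ 2 = (α₁ + n.1) ^ 2 + (α₂ + n.2) ^ 2 + w ^ 2 := norm_waveVec_sq j
  have hr2' : r ^ 2 = (α₁ + n.1) ^ 2 + (α₂ + n.2) ^ 2 + (-w) ^ 2 := by rw [hr2]; ring
  have h2 : r / 2 ≤ ‖β + w‖ := half_le_norm_betaCoef3_add hk n hj hr2
  have h1 : r / 2 ≤ ‖β - w‖ := by
    have := half_le_norm_betaCoef3_add hk n hj hr2'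
    rwa [Complex.ofReal_neg, ← sub_eq_add_neg] at this
  have hβ0 : β ≠ 0 := norm_pos_iff.1 (hb.trans_le (hβ n))
  have hre : ∀ y : ℝ, (Complex.I * (β + y)).re ≤ 0 := by
    intro y
    have := betaCoef3_im_nonneg (k := k) (α₁ := α₁) (α₂ := α₂) n
    simpa [Complex.mul_re] using this
  have hre1 : (Complex.I * (β - w)).re ≤ 0 := by
    have := hre (-w)
    rwa [Complex.ofReal_neg, ← sub_eq_add_neg] at this
  refine norm_sub_le_of_expansions hβ0 hj hk ?_ ?_ h1 h2 hA hB
    (hA' _ (mul_ne_zero Complex.I_ne_zero (norm_pos_iff.1 (by linarith))) hre1)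
    (hA' _ (mul_ne_zero Complex.I_ne_zero (norm_pos_iff.1 (by linarith))) (hre w))
    (hB' _ (mul_ne_zero Complex.I_ne_zero (Complex.ofReal_ne_zero.2 (by linarith))) (by simp))
    (hB' _ (mul_ne_zero Complex.I_ne_zero (Complex.ofReal_ne_zero.2 (by linarith))) (by simp))
  · apply le_of_sq_le_sq _ (by linarith)
    rw [norm_betaCoef3_sq, abs_le]
    constructor <;> nlinarith [sq_nonneg (α₁ + n.1), sq_nonneg (α₂ + n.2), sq_nonneg w]
  · rw [betaCoef3_sq, ← Complex.ofReal_pow, ← Complex.ofReal_pow, ← Complex.ofReal_pow,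
      ← Complex.ofReal_sub, ← Complex.ofReal_sub, hr2]
    congr 1; ring

theorem finite_freqSize_lt (r : ℝ) : {j : ℤ × ℤ × ℤ | freqSize j < r}.Finite := by
  refine ((Set.finite_Icc (-⌈r⌉) ⌈r⌉).prod
    ((Set.finite_Icc (-⌈r⌉) ⌈r⌉).prod (Set.finite_Icc (-⌈r⌉) ⌈r⌉))).subset fun j hj => ?_
  have hj' : |(j.1 : ℝ)| + |(j.2.1 : ℝ)| + |(j.2.2 : ℝ)| < r := hj
  have key : ∀ l : ℤ, |(l : ℝ)| < r → l ∈ Set.Icc (-⌈r⌉) ⌈r⌉ := by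
    intro l hl
    rw [Set.mem_Icc, ← abs_le]
    have : ((|l| : ℤ) : ℝ) ≤ ⌈r⌉ := by push_cast; exact hl.le.trans (Int.le_ceil r)
    exact_mod_cast this
  have p1 := abs_nonneg (j.1 : ℝ)
  have p2 := abs_nonneg (j.2.1 : ℝ)
  have p3 := abs_nonneg (j.2.2 : ℝ)
  exact ⟨key _ (by linarith), key _ (by linarith), key _ (by linarith)⟩

theorem le_norm_waveVec (hR : 0 < R) (j : ℤ × ℤ × ℤ) :
    min 1 (π / R) * freqSize j - (|α₁| + |α₂|) ≤ 3 * ‖waveVec α₁ α₂ R j‖ := by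
  have h0 : |α₁ + j.1| ≤ ‖waveVec α₁ α₂ R j‖ := abs_coord_le_norm (waveVec α₁ α₂ R j) 0
  have h1 : |α₂ + j.2.1| ≤ ‖waveVec α₁ α₂ R j‖ := abs_coord_le_norm (waveVec α₁ α₂ R j) 1
  have h2 : |j.2.2 * π / R| ≤ ‖waveVec α₁ α₂ R j‖ := abs_coord_le_norm (waveVec α₁ α₂ R j) 2
  have t : ∀ a l : ℝ, |l| - |a| ≤ |a + l| := by
    intro a l
    have := abs_sub (a + l) a
    rw [add_sub_cancel_left] at this
    linarith
  have s0 := t α₁ j.1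
  have s1 := t α₂ j.2.1
  have s2 : |j.2.2 * π / R| = π / R * |(j.2.2 : ℝ)| := by
    rw [abs_div, abs_mul, abs_of_pos hR, abs_of_pos Real.pi_pos]; ring
  rw [s2] at h2
  have q1 := mul_le_mul_of_nonneg_right (min_le_left 1 (π / R)) (abs_nonneg (j.1 : ℝ))
  have q2 := mul_le_mul_of_nonneg_right (min_le_left 1 (π / R)) (abs_nonneg (j.2.1 : ℝ))
  have q3 := mul_le_mul_of_nonneg_right (min_le_right 1 (π / R)) (abs_nonneg (j.2.2 : ℝ))
  rw [freqSize]
  linarith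

theorem summable_freqSize_pow_mul {c : ℤ × ℤ × ℤ → ℂ} {C : ℝ} (hk : 0 < k) (hb : 0 < b)
    (hβ : ∀ n : ℤ × ℤ, b ≤ ‖betaCoef3 k α₁ α₂ n‖) (hR : 0 < R) (hC : 0 < C) {m s : ℕ} (hs : s ≤ m)
    (hc : ∀ j : ℤ × ℤ × ℤ, 4 * k ≤ ‖waveVec α₁ α₂ R j‖ → ‖c j‖ ≤
        C / (‖betaCoef3 k α₁ α₂ (j.1, j.2.1)‖ * ‖waveVec α₁ α₂ R j‖ ^ (m + 3))) :
    Summable fun j => freqSize j ^ s * ‖c j‖ := by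
  obtain ⟨κ, hκ, hκ'⟩ := exists_linear_le_norm_betaCoef3 hb hβ
  set τ := min 1 (π / R) with hτdef
  have hτ : 0 < τ := lt_min one_pos (by positivity)
  set J₀ := 1 + 2 * (|α₁| + |α₂|) / τ + 24 * k / τ with hJ₀
  refine (summable_spaceWeight.mul_left
    (C / (κ * (τ / 6) ^ (m + 3)) * 8)).of_norm_bounded_eventually ?_
  filter_upwards [(finite_freqSize_lt J₀).compl_mem_cofinite] with j hj
  have hJ : J₀ ≤ freqSize j := not_lt.1 hj
  have hJ1 : 1 ≤ freqSize j := by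
    have : 0 ≤ 2 * (|α₁| + |α₂|) / τ + 24 * k / τ := by positivity
    linarith
  have hJτ : 2 * (|α₁| + |α₂|) + 24 * k ≤ τ * freqSize j := by
    have : τ * J₀ = τ + (2 * (|α₁| + |α₂|) + 24 * k) := by rw [hJ₀]; field_simp; ring
    nlinarith
  have hJ0 : 0 < freqSize j := by linarith
  have hξ : τ / 6 * freqSize j ≤ ‖waveVec α₁ α₂ R j‖ := by
    have := le_norm_waveVec (α₁ := α₁) (α₂ := α₂) hR j
    rw [← hτdef] at this
    linarith
  have h4 : 4 * k ≤ ‖waveVec α₁ α₂ R j‖ := by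
    have h1 := abs_nonneg α₁
    have h2 := abs_nonneg α₂
    linarith
  rw [norm_mul, norm_norm, norm_pow, Real.norm_of_nonneg hJ0.le]
  calc freqSize j ^ s * ‖c j‖ ≤ freqSize j ^ m *
        (C / ((κ * (1 + |(j.1 : ℝ)| + |(j.2.1 : ℝ)|)) * (τ / 6 * freqSize j) ^ (m + 3))) := by
        gcongr
        refine (hc j h4).trans ?_
        gcongr
        exact hκ' (j.1, j.2.1)
    _ = C / (κ * (τ / 6) ^ (m + 3)) * (1 / ((1 + |(j.1 : ℝ)| + |(j.2.1 : ℝ)|) *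
          freqSize j ^ 3)) := by
        rw [mul_pow, pow_add (freqSize j)]
        field_simp
    _ ≤ C / (κ * (τ / 6) ^ (m + 3)) * (1 / ((1 + |(j.1 : ℝ)| + |(j.2.1 : ℝ)|) *
          ((1 + freqSize j) / 2) ^ 3)) := by
        gcongr
        linarith
    _ = C / (κ * (τ / 6) ^ (m + 3)) * 8 * (1 / ((1 + |(j.1 : ℝ)| + |(j.2.1 : ℝ)|) *
          (1 + |(j.1 : ℝ)| + |(j.2.1 : ℝ)| + |(j.2.2 : ℝ)|) ^ 3)) := by
        rw [div_pow, freqSize, ← add_assoc, ← add_assoc]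
        field_simp
        norm_num
    _ ≤ _ := by
        gcongr
        exact inv_le_spaceWeight (abs_nonneg _) (abs_nonneg _) (abs_nonneg _)

end CoefficientDecay

section FourierUniqueness

variable {R : ℝ} {g : EuclideanSpace ℝ (Fin 3) → ℂ}

/-- The side lengths of `domDd R`. -/
def boxPeriod (R : ℝ) : Fin 3 → ℝ := ![2 * π, 2 * π, 2 * R]

/-- The quotient map onto the torus of side lengths `boxPeriod R`. -/
def toTorus (R : ℝ) (x : EuclideanSpace ℝ (Fin 3)) : UnitAddTorus (Fin 3) :=
  fun i => ((x i / boxPeriod R i : ℝ) : UnitAddCircle)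

theorem boxPeriod_pos (hR : 0 < R) (i : Fin 3) : 0 < boxPeriod R i := by
  have := Real.pi_pos
  fin_cases i <;> simp [boxPeriod] <;> positivity

theorem mem_domDd_iff (x : EuclideanSpace ℝ (Fin 3)) :
    x ∈ domDd R ↔ ∀ i, |x i| ≤ boxPeriod R i / 2 := by
  simp [domDd, boxPeriod, Fin.forall_fin_succ, abs_le]

theorem measurableSet_domDd (R : ℝ) : MeasurableSet (domDd R) := by
  rw [domDd_eq_preimage]; exact coordSplit.measurable (measurableSet_coordBox R)

theorem continuous_toTorus (R : ℝ) : Continuous (toTorus R) :=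
  continuous_pi fun i => (AddCircle.continuous_mk' (1 : ℝ)).comp (by fun_prop)

theorem mFourier_toTorus (hR : 0 < R) (n : Fin 3 → ℤ) (x : EuclideanSpace ℝ (Fin 3)) :
    UnitAddTorus.mFourier n (toTorus R x) =
      (Real.sqrt (8 * π ^ 2 * R) : ℂ) * fBasis3 R (-(-n 0, -n 1, -n 2)) x := by
  have hpi : (π : ℂ) ≠ 0 := by exact_mod_cast Real.pi_ne_zero
  have hRC : (R : ℂ) ≠ 0 := by exact_mod_cast hR.ne'
  have hs : (Real.sqrt (8 * π ^ 2 * R) : ℂ) ≠ 0 :=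
    Complex.ofReal_ne_zero.2 (Real.sqrt_pos.2 (by positivity)).ne'
  rw [fBasis3, ← mul_assoc, Complex.ofReal_div, Complex.ofReal_one, mul_one_div_cancel hs, one_mul]
  simp only [UnitAddTorus.mFourier, ContinuousMap.coe_mk, Fin.prod_univ_three, toTorus,
    fourier_coe_apply, ← Complex.exp_add, boxPeriod]
  congr 1
  simp
  field_simp

theorem abs_sub_lt_of_dist_toTorus_lt (hR : 0 < R) {x x₀ : EuclideanSpace ℝ (Fin 3)} {δ : ℝ}
    (hδ : ∀ i, |x₀ i| + δ * boxPeriod R i ≤ boxPeriod R i / 2) (hx : x ∈ domDd R)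
    (h : dist (toTorus R x) (toTorus R x₀) < δ) (i : Fin 3) :
    |x i - x₀ i| < δ * boxPeriod R i := by
  have hT := boxPeriod_pos hR i
  have hx' := (mem_domDd_iff x).1 hx i
  have h1 : dist (toTorus R x i) (toTorus R x₀ i) < δ := (dist_le_pi_dist _ _ i).trans_lt h
  set y : ℝ := (x i - x₀ i) / boxPeriod R i with hy
  have h2 : |y - round y| < δ := by
    rw [dist_eq_norm, toTorus, toTorus, ← AddCircle.coe_sub, ← sub_div,
      UnitAddCircle.norm_eq] at h1
    exact h1
  have h3 : |y| ≤ 1 - δ := by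
    rw [hy, abs_div, abs_of_pos hT, div_le_iff₀ hT]
    have := abs_sub (x i) (x₀ i)
    have := hδ i
    linarith
  have h4 : round y = 0 := by
    by_contra hne
    have : (1 : ℝ) ≤ |(round y : ℝ)| := by exact_mod_cast Int.one_le_abs hne
    have := abs_sub_abs_le_abs_sub (round y : ℝ) y
    rw [abs_sub_comm] at this
    linarith
  rw [h4, Int.cast_zero, sub_zero, hy, abs_div, abs_of_pos hT, div_lt_iff₀ hT] at h2
  exact h2

theorem integral_mul_comp_toTorus_eq_zero (hR : 0 < R) (hg : IntegrableOn g (domDd R))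
    (h0 : ∀ j, fourierCoef3 R g j = 0) (ψ : C(UnitAddTorus (Fin 3), ℂ)) :
    ∫ x in domDd R, g x * ψ (toTorus R x) = 0 := by
  have hint : ∀ ψ : C(UnitAddTorus (Fin 3), ℂ),
      IntegrableOn (fun x => g x * ψ (toTorus R x)) (domDd R) := fun ψ =>
    Integrable.mul_bdd (c := ‖ψ‖) hg
      (ψ.continuous.comp (continuous_toTorus R)).aestronglyMeasurable
      (ae_of_all _ fun x => ψ.norm_coe_le_norm _)
  have hspan : ∀ P ∈ Submodule.span ℂ (Set.range (UnitAddTorus.mFourier (d := Fin 3))),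
      ∫ x in domDd R, g x * P (toTorus R x) = 0 := by
    intro P hP
    induction hP using Submodule.span_induction with
    | mem P hP =>
      obtain ⟨n, rfl⟩ := hP
      simp_rw [mFourier_toTorus hR, mul_left_comm (g _)]
      rw [integral_const_mul]
      have := h0 (-n 0, -n 1, -n 2)
      rw [fourierCoef3] at this
      rw [this, mul_zero]
    | zero => simp
    | add P Q _ _ hP hQ =>
      simp only [ContinuousMap.add_apply, mul_add]
      rw [integral_add (hint P) (hint Q), hP, hQ, add_zero]
    | smul a P _ hP =>
      simp only [ContinuousMap.smul_apply, smul_eq_mul, mul_left_comm (g _)]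
      rw [integral_const_mul, hP, mul_zero]
  set G := ∫ x in domDd R, ‖g x‖ with hG
  have hG0 : 0 ≤ G := integral_nonneg fun _ => norm_nonneg _
  have hmem : ψ ∈ (Submodule.span ℂ
      (Set.range (UnitAddTorus.mFourier (d := Fin 3)))).topologicalClosure := by
    rw [UnitAddTorus.span_mFourier_closure_eq_top]; trivial
  rw [← norm_le_zero_iff]
  refine le_of_forall_pos_le_add fun e he => ?_
  obtain ⟨P, hP, hPd⟩ := Metric.mem_closure_iff.1 hmem (e / (G + 1)) (by positivity)
  have hsub : ∫ x in domDd R, g x * ψ (toTorus R x) =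
      ∫ x in domDd R, g x * (ψ - P) (toTorus R x) := by
    simp only [ContinuousMap.sub_apply, mul_sub]
    rw [integral_sub (hint ψ) (hint P), hspan P hP, sub_zero]
  rw [hsub, zero_add]
  calc _ ≤ ∫ x in domDd R, ‖g x‖ * (e / (G + 1)) := by
        refine norm_integral_le_of_norm_le (hg.norm.mul_const _) (ae_of_all _ fun x => ?_)
        rw [norm_mul]
        gcongr
        rw [dist_eq_norm] at hPd
        exact ((ψ - P).norm_coe_le_norm _).trans hPd.le
    _ = G * (e / (G + 1)) := by rw [integral_mul_const]
    _ ≤ e := by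
        rw [mul_div_assoc', div_le_iff₀ (by positivity)]
        nlinarith

theorem eq_zero_of_fourierCoef3_eq_zero (hR : 0 < R) (hg : IntegrableOn g (domDd R))
    (h0 : ∀ j, fourierCoef3 R g j = 0) {x₀ : EuclideanSpace ℝ (Fin 3)}
    (hx₀ : ∀ i, |x₀ i| < boxPeriod R i / 2) (hc : ContinuousAt g x₀) : g x₀ = 0 := by
  by_contra hne
  have hpos : ∀ᶠ x in nhds x₀, 0 < ((starRingEnd ℂ) (g x₀) * g x).re := by
    have h1 : ContinuousAt (fun x => ((starRingEnd ℂ) (g x₀) * g x).re) x₀ :=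
      Complex.continuous_re.continuousAt.comp (continuousAt_const.mul hc)
    refine h1.eventually (lt_mem_nhds ?_)
    change 0 < ((starRingEnd ℂ) (g x₀) * g x₀).re
    rw [mul_comm, Complex.mul_conj]
    exact_mod_cast Complex.normSq_pos.2 hne
  have hball : ∃ r > 0, ∀ x : EuclideanSpace ℝ (Fin 3), (∀ i, |x i - x₀ i| < r) →
      0 < ((starRingEnd ℂ) (g x₀) * g x).re := by
    obtain ⟨r, hr, h⟩ := Metric.eventually_nhds_iff.1 hpos
    refine ⟨r / 3, by positivity, fun x hx => h ?_⟩
    rw [EuclideanSpace.dist_eq, Fin.sum_univ_three, Real.sqrt_lt' hr]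
    simp only [Real.dist_eq]
    have q : ∀ i, |x i - x₀ i| ^ 2 ≤ (r / 3) ^ 2 := fun i =>
      pow_le_pow_left₀ (abs_nonneg _) (hx i).le 2
    nlinarith [q 0, q 1, q 2]
  obtain ⟨r, hr, hball⟩ := hball
  obtain ⟨δ, hδ0, hδ⟩ : ∃ δ > 0, ∀ i, |x₀ i| + δ * boxPeriod R i ≤ boxPeriod R i / 2 ∧
      δ * boxPeriod R i ≤ r := by
    have hev : ∀ᶠ δ : ℝ in nhdsWithin 0 (Set.Ioi 0), ∀ i,
        |x₀ i| + δ * boxPeriod R i ≤ boxPeriod R i / 2 ∧ δ * boxPeriod R i ≤ r := by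
      refine Filter.eventually_all.2 fun i => Filter.Eventually.and ?_ ?_
      · refine nhdsWithin_le_nhds ?_
        have : Continuous fun δ : ℝ => |x₀ i| + δ * boxPeriod R i := by fun_prop
        refine (this.tendsto 0).eventually (ge_mem_nhds ?_)
        simpa using hx₀ i
      · refine nhdsWithin_le_nhds ?_
        have : Continuous fun δ : ℝ => δ * boxPeriod R i := by fun_prop
        refine (this.tendsto 0).eventually (ge_mem_nhds ?_)
        simpa using hr
    obtain ⟨δ, h, h'⟩ := (hev.and self_mem_nhdsWithin).exists
    exact ⟨δ, h', h⟩
  let ψ : C(UnitAddTorus (Fin 3), ℂ) :=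
    ⟨fun t => ((max 0 (δ - dist t (toTorus R x₀)) : ℝ) : ℂ), by fun_prop⟩
  set H : EuclideanSpace ℝ (Fin 3) → ℝ := fun x =>
    ((starRingEnd ℂ) (g x₀) * g x).re * max 0 (δ - dist (toTorus R x) (toTorus R x₀)) with hH
  have hHre : ∀ x, H x = ((starRingEnd ℂ) (g x₀) * (g x * ψ (toTorus R x))).re := by
    intro x
    simp only [hH, ψ, ContinuousMap.coe_mk]
    rw [← mul_assoc, Complex.re_mul_ofReal]
  have hint : IntegrableOn (fun x => (starRingEnd ℂ) (g x₀) * (g x * ψ (toTorus R x)))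
      (domDd R) := by
    refine Integrable.const_mul (Integrable.mul_bdd (c := ‖ψ‖) hg
      (ψ.continuous.comp (continuous_toTorus R)).aestronglyMeasurable
      (ae_of_all _ fun x => ψ.norm_coe_le_norm _)) _
  have hHint : IntegrableOn H (domDd R) := by
    rw [show H = fun x => _ from funext hHre]
    exact hint.re
  have hzero : ∫ x in domDd R, H x = 0 := by
    simp_rw [hHre]
    have := integral_re hint
    simp only [RCLike.re_to_complex] at this
    rw [this, integral_const_mul, integral_mul_comp_toTorus_eq_zero hR hg h0, mul_zero,
      Complex.zero_re]
  have hnn : 0 ≤ᵐ[volume.restrict (domDd R)] H := by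
    filter_upwards [ae_restrict_mem (measurableSet_domDd R)] with x hx
    rcases lt_or_ge (dist (toTorus R x) (toTorus R x₀)) δ with hd | hd
    · have := hball x fun i => (abs_sub_lt_of_dist_toTorus_lt hR (fun i => (hδ i).1) hx hd i).trans_le
        (hδ i).2
      simp only [hH, Pi.zero_apply]
      positivity
    · simp [hH, max_eq_left (sub_nonpos.2 hd)]
  have hae := (integral_eq_zero_iff_of_nonneg_ae hnn hHint).1 hzero
  have hnhds : ∀ᶠ x in nhds x₀, x ∈ domDd R ∧ H x ≠ 0 := by
    have e1 : ∀ᶠ x in nhds x₀, ∀ i, |x i| < boxPeriod R i / 2 :=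
      Filter.eventually_all.2 fun i => by
        have : Continuous fun x : EuclideanSpace ℝ (Fin 3) => |x i| := by fun_prop
        exact (this.tendsto x₀).eventually (gt_mem_nhds (hx₀ i))
    have e2 : ∀ᶠ x in nhds x₀, dist (toTorus R x) (toTorus R x₀) < δ := by
      have : Continuous fun x => dist (toTorus R x) (toTorus R x₀) :=
        (continuous_toTorus R).dist continuous_const
      refine (this.tendsto x₀).eventually (gt_mem_nhds ?_)
      simpa using hδ0
    filter_upwards [e1, e2, hpos] with x h1 h2 h3
    refine ⟨(mem_domDd_iff x).2 fun i => (h1 i).le, ?_⟩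
    have : 0 < max 0 (δ - dist (toTorus R x) (toTorus R x₀)) := lt_max_of_lt_right (by linarith)
    exact (mul_pos h3 this).ne'
  have hm := Measure.measure_pos_of_mem_nhds volume hnhds
  rw [Filter.EventuallyEq, ae_restrict_iff' (measurableSet_domDd R), ae_iff] at hae
  refine hm.ne' (measure_mono_null (fun x hx => ?_) hae)
  exact fun hcon => hx.2 (hcon hx.1)

theorem continuous_tsum_fBasis3 {a : ℤ × ℤ × ℤ → ℂ} (ha : Summable fun j => ‖a j‖) :
    Continuous fun x => ∑' j, a j * fBasis3 R j x :=
  continuous_tsum (fun j => continuous_const.mul (continuous_fBasis3 R j))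
    (ha.mul_right (1 / Real.sqrt (8 * π ^ 2 * R))) fun j x => by rw [norm_mul, norm_fBasis3]

theorem volume_domDd_lt_top (R : ℝ) : volume (domDd R) < ⊤ := by
  rw [domDd_eq_preimage, measurePreserving_coordSplit.measure_preimage
    (measurableSet_coordBox R).nullMeasurableSet]
  exact (isCompact_coordBox R).measure_lt_top

theorem integrableOn_tsum_fBasis3 {a : ℤ × ℤ × ℤ → ℂ} (ha : Summable fun j => ‖a j‖) :
    IntegrableOn (fun x => ∑' j, a j * fBasis3 R j x) (domDd R) := by
  refine IntegrableOn.of_bound (volume_domDd_lt_top R)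
    (continuous_tsum_fBasis3 ha).aestronglyMeasurable
    (∑' j, ‖a j‖ * (1 / Real.sqrt (8 * π ^ 2 * R))) (ae_of_all _ fun x => ?_)
  exact tsum_of_norm_bounded (ha.mul_right _).hasSum fun j => by rw [norm_mul, norm_fBasis3]

theorem fourierCoef3_tsum_fBasis3 (hR : 0 < R) {a : ℤ × ℤ × ℤ → ℂ} (ha : Summable fun j => ‖a j‖)
    (j : ℤ × ℤ × ℤ) : fourierCoef3 R (fun x => ∑' i, a i * fBasis3 R i x) j = a j := by
  have hfin : IsFiniteMeasure (volume.restrict (domDd R)) :=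
    ⟨by simpa using volume_domDd_lt_top R⟩
  have hF : ∀ i, Integrable (fun x => a i * fBasis3 R i x * fBasis3 R (-j) x)
      (volume.restrict (domDd R)) := by
    intro i
    refine Integrable.of_bound
      ((continuous_const.mul (continuous_fBasis3 R i)).mul
        (continuous_fBasis3 R (-j))).aestronglyMeasurable
      (‖a i‖ * (1 / Real.sqrt (8 * π ^ 2 * R)) * (1 / Real.sqrt (8 * π ^ 2 * R)))
      (ae_of_all _ fun x => ?_)
    rw [norm_mul, norm_mul, norm_fBasis3, norm_fBasis3]
  have hS : Summable fun i => ∫ x in domDd R, ‖a i * fBasis3 R i x * fBasis3 R (-j) x‖ := by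
    simp_rw [norm_mul, norm_fBasis3, integral_const]
    exact ((ha.mul_right _).mul_right _).const_smul _
  have := (hasSum_integral_of_summable_integral_norm hF hS).tsum_eq
  rw [fourierCoef3]
  simp_rw [← tsum_mul_right]
  rw [← this, tsum_eq_single j]
  · simp_rw [mul_assoc, integral_const_mul, integral_fBasis3_mul hR]; simp
  · intro i hi
    simp_rw [mul_assoc, integral_const_mul, integral_fBasis3_mul hR, if_neg hi, mul_zero]

theorem tsum_fourierCoef3_mul_fBasis3 (hR : 0 < R) (hg : IntegrableOn g (domDd R))
    (ha : Summable fun j => ‖fourierCoef3 R g j‖) {x₀ : EuclideanSpace ℝ (Fin 3)}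
    (hx₀ : ∀ i, |x₀ i| < boxPeriod R i / 2) (hc : ContinuousAt g x₀) :
    g x₀ = ∑' j, fourierCoef3 R g j * fBasis3 R j x₀ := by
  rw [← sub_eq_zero]
  have hS := integrableOn_tsum_fBasis3 (R := R) ha
  refine eq_zero_of_fourierCoef3_eq_zero (g := fun x =>
    g x - ∑' j, fourierCoef3 R g j * fBasis3 R j x) hR (hg.sub hS) (fun j => ?_) hx₀
    (hc.sub (continuous_tsum_fBasis3 ha).continuousAt)
  have := fourierCoef3_tsum_fBasis3 hR ha j
  rw [fourierCoef3] at this ⊢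
  simp_rw [sub_mul]
  rw [integral_sub (integrableOn_mul_fBasis3 hg _) (integrableOn_mul_fBasis3 hS _), this,
    fourierCoef3, sub_self]

end FourierUniqueness

section Truncation

theorem le_freqSize_of_notMem_cubeIdx {N : ℕ} {j : ℤ × ℤ × ℤ} (hj : j ∉ cubeIdx N) :
    (N : ℝ) ≤ freqSize j := by
  by_contra! hlt
  have h : |j.1| + |j.2.1| + |j.2.2| < (N : ℤ) := by
    rw [freqSize] at hlt; exact_mod_cast hlt
  apply hj
  have h1 := abs_nonneg j.1
  have h2 := abs_nonneg j.2.1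
  have h3 := abs_nonneg j.2.2
  have k1 := abs_lt.1 (show |j.1| < (N : ℤ) by linarith)
  have k2 := abs_lt.1 (show |j.2.1| < (N : ℤ) by linarith)
  have k3 := abs_lt.1 (show |j.2.2| < (N : ℤ) by linarith)
  simp only [cubeIdx, Finset.mem_product, Finset.mem_Icc]
  lia

theorem norm_tsum_sub_sum_cubeIdx_le {R : ℝ} {a : ℤ × ℤ × ℤ → ℂ} {s N : ℕ} (hN : 0 < N)
    (ha : Summable fun j => ‖a j‖) (hW : Summable fun j => freqSize j ^ s * ‖a j‖)
    (x : EuclideanSpace ℝ (Fin 3)) :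
    ‖∑' j, a j * fBasis3 R j x - ∑ j ∈ cubeIdx N, a j * fBasis3 R j x‖ ≤
      1 / Real.sqrt (8 * π ^ 2 * R) * (∑' j, freqSize j ^ s * ‖a j‖) / (N : ℝ) ^ s := by
  have hNR : (0 : ℝ) < N := by exact_mod_cast hN
  have hS : Summable fun j => a j * fBasis3 R j x := by
    apply Summable.of_norm
    simp_rw [norm_mul, norm_fBasis3]
    exact ha.mul_right _
  rw [← hS.sum_add_tsum_subtype_compl (cubeIdx N), add_sub_cancel_left]
  have hW0 : ∀ j, 0 ≤ freqSize j ^ s * ‖a j‖ := fun j =>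
    mul_nonneg (pow_nonneg (freqSize_nonneg j) _) (norm_nonneg _)
  have hW' := hW.mul_left (1 / Real.sqrt (8 * π ^ 2 * R) / (N : ℝ) ^ s)
  have hb : ‖∑' j : {j // j ∉ cubeIdx N}, a j * fBasis3 R j x‖ ≤
      ∑' j : {j // j ∉ cubeIdx N},
        1 / Real.sqrt (8 * π ^ 2 * R) / (N : ℝ) ^ s * (freqSize j ^ s * ‖a j‖) := by
    refine tsum_of_norm_bounded (hW'.subtype _).hasSum fun j => ?_
    rw [norm_mul, norm_fBasis3]
    have := pow_le_pow_left₀ hNR.le (le_freqSize_of_notMem_cubeIdx j.2) s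
    calc ‖a j‖ * (1 / Real.sqrt (8 * π ^ 2 * R))
        = 1 / Real.sqrt (8 * π ^ 2 * R) / (N : ℝ) ^ s * ((N : ℝ) ^ s * ‖a j‖) := by field_simp
      _ ≤ 1 / Real.sqrt (8 * π ^ 2 * R) / (N : ℝ) ^ s * (freqSize j ^ s * ‖a j‖) := by gcongr
  refine hb.trans ((hW'.tsum_subtype_le _ _ fun j => ?_).trans ?_)
  · have := hW0 j
    positivity
  · rw [tsum_mul_left]; apply le_of_eq; ring

end Truncation

section FourierRepresentation

variable {k α₁ α₂ b M R ρ : ℝ} {𝒳 𝒴 : ℝ → ℝ}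

theorem funLd_eq_tsum (hk : 0 < k) (hb : 0 < b)
    (hβ : ∀ n : ℤ × ℤ, b ≤ ‖betaCoef3 k α₁ α₂ n‖) (h𝒳 : Continuous 𝒳) (hM : ∀ t, |𝒳 t| ≤ M)
    (hR : 0 < R) (h𝒴 : Continuous 𝒴) (h𝒴0 : ∀ t, ρ ≤ t → 𝒴 t = 0)
    (ha : Summable fun j => ‖fourierCoef3 R (funLd k α₁ α₂ 𝒳 𝒴) j‖)
    {x : EuclideanSpace ℝ (Fin 3)} (hx : x ∈ domDd R) (hx2 : x 2 ≠ 0) :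
    funLd k α₁ α₂ 𝒳 𝒴 x =
      ∑' j, fourierCoef3 R (funLd k α₁ α₂ 𝒳 𝒴) j * fBasis3 R j x := by
  have hint : IntegrableOn (funLd k α₁ α₂ 𝒳 𝒴) (domDd R) :=
    (integrableOn_funKd hk hb hβ h𝒳 hM hR).sub (integrable_funF3 h𝒴 h𝒴0).integrableOn
  have hcont : ∀ y : EuclideanSpace ℝ (Fin 3), y 2 ≠ 0 →
      ContinuousAt (funLd k α₁ α₂ 𝒳 𝒴) y := fun y hy =>
    (continuousAt_funKd hk hb hβ h𝒳 hM y hy).sub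
      (continuousAt_funF3 h𝒴 fun h => hy (by simp [h]))
  have hscale : Filter.Tendsto (fun s : ℝ => s • x) (nhdsWithin 1 (Set.Iio 1)) (nhds x) := by
    have : Continuous fun s : ℝ => s • x := by fun_prop
    simpa using (this.tendsto 1).mono_left nhdsWithin_le_nhds
  refine tendsto_nhds_unique ((hcont x hx2).tendsto.comp hscale) (Filter.Tendsto.congr' ?_
    (((continuous_tsum_fBasis3 ha).tendsto x).comp hscale))
  have hIoo : Set.Ioo (0 : ℝ) 1 ∈ nhdsWithin (1 : ℝ) (Set.Iio 1) :=
    Ioo_mem_nhdsLT one_pos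
  filter_upwards [hIoo] with s hs
  refine (tsum_fourierCoef3_mul_fBasis3 hR hint ha (fun i => ?_) (hcont _ ?_)).symm
  · have hi := (mem_domDd_iff x).1 hx i
    have hT := boxPeriod_pos hR i
    rw [PiLp.smul_apply, smul_eq_mul, abs_mul, abs_of_pos hs.1]
    linarith [mul_le_mul_of_nonneg_left hi hs.1.le, mul_lt_mul_of_pos_right hs.2 hT]
  · rw [PiLp.smul_apply, smul_eq_mul]
    exact mul_ne_zero hs.1.ne' hx2

end FourierRepresentation

/-- Theorem 5.4: with FFT error O(N⁻²) on the Fourier coefficients and interpolation error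
O(N⁻⁴), the computed Green's function G̃_{dN}(x) = e^{iα₁x₁+iα₂x₂}(Ĩ_N(x) + F(x)) satisfies
|G_d(x) − G̃_{dN}(x)| ≤ C N^{−σ} on [−π,π]²×[−c,c], where σ = min{2,m}. -/
theorem statement17 (m : ℕ) (hm : 0 < m) (k α₁ α₂ c ct ε : ℝ) (hk : 0 < k)
    (hc : 0 < c) (hcct : c < ct) (hε : 0 < ε) (hε' : ε < min 1 ct / 2)
    (b : ℝ) (hb : 0 < b) (hβ : ∀ n : ℤ × ℤ, b ≤ ‖betaCoef3 k α₁ α₂ n‖)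
    (𝒳 : ℝ → ℝ) (h𝒳 : ContDiff ℝ (m + 3) 𝒳)
    (h𝒳1 : ∀ t : ℝ, |t| ≤ c → 𝒳 t = 1)
    (h𝒳0 : ∀ t : ℝ, (c + ct) / 2 ≤ |t| → 𝒳 t = 0)
    (𝒴 : ℝ → ℝ) (h𝒴 : ContDiff ℝ (m + 3) 𝒴)
    (h𝒴1 : ∀ t : ℝ, t ≤ ε → 𝒴 t = 1)
    (h𝒴0 : ∀ t : ℝ, 2 * ε ≤ t → 𝒴 t = 0)
    (C₀ C₁ : ℝ) (hC₀ : 0 < C₀) (hC₁ : 0 < C₁) :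
    ∃ C > (0 : ℝ), ∀ N : ℕ, 0 < N →
      ∀ Ltil : ℤ × ℤ × ℤ → ℂ,
        (∑ j ∈ cubeIdx N, ‖fourierCoef3 ct (funLd k α₁ α₂ 𝒳 𝒴) j - Ltil j‖ ≤
          C₀ / (N : ℝ) ^ 2) →
        ∀ Itil : EuclideanSpace ℝ (Fin 3) → ℂ,
          (∀ x ∈ domDd ct,
            ‖Itil x - ∑ j ∈ cubeIdx N, Ltil j * fBasis3 ct j x‖ ≤ C₁ / (N : ℝ) ^ 4) →
          ∀ x : EuclideanSpace ℝ (Fin 3),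
            x 0 ∈ Set.Icc (-π) π → x 1 ∈ Set.Icc (-π) π → x 2 ∈ Set.Icc (-c) c →
            x 2 ≠ 0 →
              ‖greenGd k α₁ α₂ x -
                  Complex.exp (Complex.I * (α₁ : ℂ) * (x 0 : ℂ) +
                      Complex.I * (α₂ : ℂ) * (x 1 : ℂ)) *
                    (Itil x + funF3 k α₁ α₂ 𝒴 x)‖ ≤
                C / (N : ℝ) ^ (min 2 m) := by
  have hct : 0 < ct := hc.trans hcct
  obtain ⟨ρ, hερ, hρ1, hρct⟩ : ∃ ρ, 2 * ε < ρ ∧ ρ ≤ 1 ∧ ρ ≤ ct :=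
    ⟨min 1 ct, by linarith, min_le_left _ _, min_le_right _ _⟩
  have hρ : 0 < ρ := by linarith
  have hρπ : ρ ≤ π := by linarith [Real.pi_gt_three]
  have h𝒳' : ContDiff ℝ ((m + 3 : ℕ) : WithTop ℕ∞) 𝒳 := by exact_mod_cast h𝒳
  have h𝒴' : ContDiff ℝ ((m + 3 : ℕ) : WithTop ℕ∞) 𝒴 := by exact_mod_cast h𝒴
  have h𝒴ρ : ∀ t, ρ ≤ t → 𝒴 t = 0 := fun t ht => h𝒴0 t (by linarith)
  have e𝒳1 : 𝒳 =ᶠ[nhds 0] fun _ => 1 := by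
    filter_upwards [Icc_mem_nhds (neg_lt_zero.2 hc) hc] with t ht
    exact h𝒳1 t (abs_le.2 ht)
  have e𝒳0 : 𝒳 =ᶠ[nhds ct] fun _ => 0 := by
    filter_upwards [lt_mem_nhds (show (c + ct) / 2 < ct by linarith)] with t ht
    exact h𝒳0 t ((le_of_lt ht).trans (le_abs_self t))
  have e𝒴1 : 𝒴 =ᶠ[nhds 0] fun _ => 1 := by
    filter_upwards [gt_mem_nhds hε] with t ht
    exact h𝒴1 t (le_of_lt ht)
  have e𝒴0 : 𝒴 =ᶠ[nhds ρ] fun _ => 0 := by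
    filter_upwards [lt_mem_nhds hερ] with t ht
    exact h𝒴0 t (le_of_lt ht)
  obtain ⟨M, hM⟩ : ∃ M, ∀ t, |𝒳 t| ≤ M := by
    obtain ⟨M, hM⟩ := (isCompact_Icc (a := -ct) (b := ct)).exists_bound_of_continuousOn
      h𝒳'.continuous.continuousOn
    refine ⟨M, fun t => ?_⟩
    rcases le_or_gt |t| ct with h | h
    · exact hM t (abs_le.1 h)
    · rw [h𝒳0 t (by linarith), abs_zero]
      exact (norm_nonneg _).trans (hM 0 ⟨by linarith, hct.le⟩)
  obtain ⟨D, hD, hdecay⟩ := exists_norm_fourierCoef3_funLd_le hk hb hβ (p := m + 3) (by lia) h𝒳' hM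
    hct e𝒳1 e𝒳0 h𝒴' hρ hρπ hρct e𝒴1 e𝒴0 h𝒴ρ
  have hsum : Summable fun j => ‖fourierCoef3 ct (funLd k α₁ α₂ 𝒳 𝒴) j‖ := by
    simpa using summable_freqSize_pow_mul hk hb hβ hct hD (Nat.zero_le m) hdecay
  have hW := summable_freqSize_pow_mul hk hb hβ hct hD (min_le_right 2 m) hdecay
  set W := ∑' j, freqSize j ^ min 2 m * ‖fourierCoef3 ct (funLd k α₁ α₂ 𝒳 𝒴) j‖ with hWdef
  have hW0 : 0 ≤ W := tsum_nonneg fun j =>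
    mul_nonneg (pow_nonneg (freqSize_nonneg j) _) (norm_nonneg _)
  set r := 1 / Real.sqrt (8 * π ^ 2 * ct) with hr
  have hr0 : 0 < r := by positivity
  refine ⟨r * W + r * C₀ + C₁, by positivity, fun N hN Ltil hL Itil hI x hx0 hx1 hx2 hx2' => ?_⟩
  have hNR : (1 : ℝ) ≤ N := by exact_mod_cast hN
  have hx : x ∈ domDd ct := ⟨hx0, hx1, by linarith [hx2.1], by linarith [hx2.2]⟩
  have hrep := funLd_eq_tsum hk hb hβ h𝒳'.continuous hM hct h𝒴'.continuous h𝒴ρ hsum hx hx2'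
  have hG : greenGd k α₁ α₂ x -
        Complex.exp (Complex.I * (α₁ : ℂ) * (x 0 : ℂ) + Complex.I * (α₂ : ℂ) * (x 1 : ℂ)) *
          (Itil x + funF3 k α₁ α₂ 𝒴 x) =
      Complex.exp (Complex.I * (α₁ : ℂ) * (x 0 : ℂ) + Complex.I * (α₂ : ℂ) * (x 1 : ℂ)) *
        (funLd k α₁ α₂ 𝒳 𝒴 x - Itil x) := by
    have hone : Complex.exp (Complex.I * (α₁ : ℂ) * (x 0 : ℂ) + Complex.I * (α₂ : ℂ) * (x 1 : ℂ)) *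
        Complex.exp (-Complex.I * (α₁ : ℂ) * (x 0 : ℂ) - Complex.I * (α₂ : ℂ) * (x 1 : ℂ)) = 1 := by
      rw [← Complex.exp_add, ← Complex.exp_zero]; congr 1; ring
    rw [funLd, funKd, h𝒳1 |x 2| (by rw [abs_abs]; exact abs_le.2 hx2), Complex.ofReal_one]
    linear_combination -(greenGd k α₁ α₂ x) * hone
  have hexp : ‖Complex.exp (Complex.I * (α₁ : ℂ) * (x 0 : ℂ) + Complex.I * (α₂ : ℂ) * (x 1 : ℂ))‖ =
      1 := by
    rw [Complex.norm_exp]; simp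
  rw [hG, norm_mul, hexp, one_mul]
  have t1 : ‖funLd k α₁ α₂ 𝒳 𝒴 x - funLdN k α₁ α₂ ct 𝒳 𝒴 N x‖ ≤ r * W / (N : ℝ) ^ min 2 m := by
    rw [hrep]
    exact norm_tsum_sub_sum_cubeIdx_le hN hsum hW x
  have t2 : ‖funLdN k α₁ α₂ ct 𝒳 𝒴 N x - ∑ j ∈ cubeIdx N, Ltil j * fBasis3 ct j x‖ ≤
      r * C₀ / (N : ℝ) ^ min 2 m := by
    rw [funLdN, ← Finset.sum_sub_distrib]
    calc _ ≤ ∑ j ∈ cubeIdx N, ‖fourierCoef3 ct (funLd k α₁ α₂ 𝒳 𝒴) j - Ltil j‖ * r := by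
          refine (norm_sum_le _ _).trans (Finset.sum_le_sum fun j _ => ?_)
          rw [← sub_mul, norm_mul, norm_fBasis3]
      _ ≤ C₀ / (N : ℝ) ^ 2 * r := by
          rw [← Finset.sum_mul]; gcongr
      _ ≤ C₀ / (N : ℝ) ^ min 2 m * r := by
          gcongr
          exact min_le_left 2 m
      _ = _ := by ring
  have t3 : ‖Itil x - ∑ j ∈ cubeIdx N, Ltil j * fBasis3 ct j x‖ ≤ C₁ / (N : ℝ) ^ min 2 m := by
    refine (hI x hx).trans ?_
    gcongr
    exact (min_le_left 2 m).trans (by norm_num)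
  rw [norm_sub_rev] at t3
  calc ‖funLd k α₁ α₂ 𝒳 𝒴 x - Itil x‖
      = ‖(funLd k α₁ α₂ 𝒳 𝒴 x - funLdN k α₁ α₂ ct 𝒳 𝒴 N x) +
          (funLdN k α₁ α₂ ct 𝒳 𝒴 N x - ∑ j ∈ cubeIdx N, Ltil j * fBasis3 ct j x) +
          (∑ j ∈ cubeIdx N, Ltil j * fBasis3 ct j x - Itil x)‖ := by congr 1; ring
    _ ≤ r * W / (N : ℝ) ^ min 2 m + r * C₀ / (N : ℝ) ^ min 2 m + C₁ / (N : ℝ) ^ min 2 m :=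
        norm_add₃_le.trans (add_le_add (add_le_add t1 t2) t3)
    _ = _ := by ring

end
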